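/- Let (μ_t)_{t≥0} be a compactly supported measure-valued probability solution of the kinetic herding equation with centered means, and assume 0 < φ_m ≤ φ ≤ φ_M. Then the velocity variance vanishes asymptotically: lim_{t→∞} V(t) = 0, where V(t) = ∫ |v|² dμ_t(x,v). (This follows since t ↦ ∫_0^t V(s) ds is bounded and increasing, and |V'(t)| ≤ max{1 + 2(λ_x/λ_w)φ_M, λ_w + 2λ_x φ_M + 2λ_v φ_M} E(0) is uniformly bounded, so Barbalat's lemma applies.) -/

import Mathlib

open MeasureTheory Filter Set RealInnerProductSpace

noncomputable section

abbrev Euc (d : ℕ) := EuclideanSpace ℝ (Fin d)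
abbrev Phase (d : ℕ) := Euc d × Euc d

/-- The nonlocal herding force `Q(x,v,μ)`. -/
noncomputable def herdQ {d : ℕ} (lw lx lv : ℝ) (φ : ℝ → ℝ) (μ : Measure (Phase d))
    (x v : Euc d) : Euc d :=
  ∫ z, (lw • (z.1 - x) + (lx * φ ‖x - z.1‖) • (z.1 - x)
      + (lv * φ ‖x - z.1‖) • (z.2 - v)) ∂μ

/-- Measure-valued solution of the kinetic herding equation on the time set `S`:
(i) finiteness, (ii) weak continuity in time against functions vanishing at infinity,
(iii) the weak formulation against compactly supported `C¹` test functions. -/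
def IsMVSol {d : ℕ} (lw lx lv : ℝ) (φ : ℝ → ℝ) (S : Set ℝ)
    (μ : ℝ → Measure (Phase d)) : Prop :=
  (∀ t ∈ S, IsFiniteMeasure (μ t)) ∧
  (∀ g : ZeroAtInftyContinuousMap (Phase d) ℝ,
      ContinuousOn (fun t => ∫ z, g z ∂(μ t)) S) ∧
  (∀ g : Phase d × ℝ → ℝ, ContDiff ℝ 1 g → HasCompactSupport g →
    ∀ t ∈ S,
      (∫ z, g (z, t) ∂(μ t)) - (∫ z, g (z, 0) ∂(μ 0)) =
      ∫ s in (0:ℝ)..t, (∫ z,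
        (deriv (fun u => g (z, u)) s
          + (fderiv ℝ (fun y => g ((y, z.2), s)) z.1) z.2
          + (fderiv ℝ (fun w => g ((z.1, w), s)) z.2)
              (herdQ lw lx lv φ (μ s) z.1 z.2)) ∂(μ s)))

/-- Topological support of a measure. -/
def msupport {d : ℕ} (μ : Measure (Phase d)) : Set (Phase d) :=
  {z | ∀ U : Set (Phase d), IsOpen U → z ∈ U → 0 < μ U}

/-- A measure has compact support. -/
def MeasureCompactSupport {d : ℕ} (μ : Measure (Phase d)) : Prop :=
  ∃ K : Set (Phase d), IsCompact K ∧ μ Kᶜ = 0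

/-- Wasserstein-1 distance in duality formulation: supremum of `|∫ g dμ - ∫ g dν|` over
functions `g` with `sup |g| ≤ 1` and Lipschitz constant `≤ 1`. -/
noncomputable def W1 {d : ℕ} (μ ν : Measure (Phase d)) : ℝ :=
  sSup {r : ℝ | ∃ g : Phase d → ℝ, (∀ z, |g z| ≤ 1) ∧ LipschitzWith 1 g ∧
    r = |(∫ z, g z ∂μ) - ∫ z, g z ∂ν|}

/-- Position variance functional `X(t)` (centered solutions). -/
noncomputable def Xfun {d : ℕ} (μ : ℝ → Measure (Phase d)) (t : ℝ) : ℝ :=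
  ∫ z, ‖z.1‖ ^ 2 ∂(μ t)

/-- Velocity variance functional `V(t)` (centered solutions). -/
noncomputable def Vfun {d : ℕ} (μ : ℝ → Measure (Phase d)) (t : ℝ) : ℝ :=
  ∫ z, ‖z.2‖ ^ 2 ∂(μ t)

/-- Covariance functional `C(X,V)(t)`. -/
noncomputable def Cfun {d : ℕ} (μ : ℝ → Measure (Phase d)) (t : ℝ) : ℝ :=
  ∫ z, ⟪z.1, z.2⟫ ∂(μ t)

/-- Weighted position energy `X_φ(t)`. -/
noncomputable def Xphi {d : ℕ} (φ : ℝ → ℝ) (μ : ℝ → Measure (Phase d)) (t : ℝ) : ℝ :=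
  ∫ z, (∫ w, φ ‖z.1 - w.1‖ * ‖z.1 - w.1‖ ^ 2 ∂(μ t)) ∂(μ t)

/-- Weighted velocity energy `V_φ(t)`. -/
noncomputable def Vphi {d : ℕ} (φ : ℝ → ℝ) (μ : ℝ → Measure (Phase d)) (t : ℝ) : ℝ :=
  ∫ z, (∫ w, φ ‖z.1 - w.1‖ * ‖z.2 - w.2‖ ^ 2 ∂(μ t)) ∂(μ t)

/-- Weighted covariance `C_φ(X,V)(t)`. -/
noncomputable def Cphi {d : ℕ} (φ : ℝ → ℝ) (μ : ℝ → Measure (Phase d)) (t : ℝ) : ℝ :=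
  ∫ z, (∫ w, φ ‖z.1 - w.1‖ * ⟪z.1 - w.1, z.2 - w.2⟫ ∂(μ t)) ∂(μ t)

/-- The potential `Φ(r) = (1/2) ∫_0^{r²} φ(√s) ds`. -/
noncomputable def Phifun (φ : ℝ → ℝ) (r : ℝ) : ℝ :=
  (1 / 2) * ∫ s in (0:ℝ)..(r ^ 2), φ (Real.sqrt s)

/-- Auxiliary (potential) functional `M(t)`. -/
noncomputable def Mfun {d : ℕ} (φ : ℝ → ℝ) (μ : ℝ → Measure (Phase d)) (t : ℝ) : ℝ :=
  ∫ z, (∫ w, Phifun φ ‖z.1 - w.1‖ ∂(μ t)) ∂(μ t)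

open Topology


lemma integrable_of_cpt {α E : Type*} [TopologicalSpace α] [T2Space α] [MeasurableSpace α] [BorelSpace α]
    [SecondCountableTopology α] [TopologicalSpace.PseudoMetrizableSpace α]
    [NormedAddCommGroup E] {ν : Measure α} [IsFiniteMeasure ν]
    (h : ∃ K : Set α, IsCompact K ∧ ν Kᶜ = 0) {f : α → E} (hf : Continuous f) :
    Integrable f ν := by
  obtain ⟨K, hK, h0⟩ := h
  have h1 : ν.restrict K = ν := Measure.restrict_eq_self_of_ae_mem (by
    rw [ae_iff]; exact h0)
  have h2 : IntegrableOn f K ν := hf.continuousOn.integrableOn_compact hK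
  rw [IntegrableOn, h1] at h2
  exact h2

lemma prod_cpt {d : ℕ} {ν ρ : Measure (Phase d)} [IsFiniteMeasure ν] [IsFiniteMeasure ρ]
    (h : MeasureCompactSupport ν) (h' : MeasureCompactSupport ρ) :
    ∃ K : Set (Phase d × Phase d), IsCompact K ∧ (ν.prod ρ) Kᶜ = 0 := by
  obtain ⟨K, hK, h0⟩ := h
  obtain ⟨L, hL, h1⟩ := h'
  refine ⟨K ×ˢ L, hK.prod hL, ?_⟩
  rw [compl_prod_eq_union]
  refine measure_union_null ?_ ?_ <;> rw [Measure.prod_prod] <;> simp [h0, h1]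

lemma lsc_of_approx {T : Type*} [TopologicalSpace T] (I : T → ℝ) (J : ℕ → T → ℝ)
    (hc : ∀ n, Continuous (J n)) (hle : ∀ n t, J n t ≤ I t)
    (ht : ∀ t, Tendsto (fun n => J n t) atTop (𝓝 (I t))) : LowerSemicontinuous I := by
  intro t y hy
  obtain ⟨n, hn⟩ := ((ht t).eventually (lt_mem_nhds hy)).exists
  filter_upwards [(hc n).continuousAt.eventually (lt_mem_nhds hn)] with s hs
  exact hs.trans_le (hle n s)

lemma cont_of_lsc {T : Type*} [TopologicalSpace T] (A B : T → ℝ) (hA : Continuous A)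
    (h1 : LowerSemicontinuous (fun t => A t - B t)) (h2 : LowerSemicontinuous (fun t => A t + B t)) :
    Continuous B := by
  rw [continuous_iff_lower_upperSemicontinuous]
  constructor
  · have := h2.add (hA.neg.lowerSemicontinuous)
    convert this using 2; simp
  · have := (h1.add (hA.neg.lowerSemicontinuous))
    intro t y hy
    have := this t (-y) (by simp; linarith)
    filter_upwards [this] with s hs
    simp at hs; linarith

/-- interaction kernel -/
def qk {d : ℕ} (lw lx lv : ℝ) (φ : ℝ → ℝ) (z w : Phase d) : Euc d :=
  lw • (w.1 - z.1) + (lx * φ ‖z.1 - w.1‖) • (w.1 - z.1) + (lv * φ ‖z.1 - w.1‖) • (w.2 - z.2)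

def Nn {d : ℕ} (z : Phase d) : ℝ := ‖z.1‖ ^ 2 + ‖z.2‖ ^ 2

def Fop {d : ℕ} (lw lx lv : ℝ) (φ : ℝ → ℝ) (ν : ℝ → Measure (Phase d)) (h : Phase d → ℝ) (s : ℝ) : ℝ :=
  ∫ z, (∫ w, (fderiv ℝ h z) (z.2, qk lw lx lv φ z w) ∂(ν s)) ∂(ν s)

structure HS {d : ℕ} (lw lx lv φM : ℝ) (φ : ℝ → ℝ) (ν : ℝ → Measure (Phase d)) : Prop where
  lw0 : 0 < lw
  lx0 : 0 < lx
  lv0 : 0 < lv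
  cφ : Continuous φ
  φ0 : ∀ r, 0 ≤ φ r
  φM : ∀ r, φ r ≤ φM
  prob : ∀ t, IsProbabilityMeasure (ν t)
  cpt : ∀ t, MeasureCompactSupport (ν t)
  vague : ∀ g : ZeroAtInftyContinuousMap (Phase d) ℝ, Continuous (fun t => ∫ z, g z ∂(ν t))
  weak : ∀ h : Phase d → ℝ, ContDiff ℝ 1 h → HasCompactSupport h → ∀ a b : ℝ, 0 ≤ a → a ≤ b →
    IntervalIntegrable (Fop lw lx lv φ ν h) volume a b ∧
    ∫ z, h z ∂(ν b) - ∫ z, h z ∂(ν a) = ∫ s in a..b, Fop lw lx lv φ ν h s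
  neg : ∀ t ≤ 0, ν t = ν 0
  c1 : ∀ t, ∫ z, z.1 ∂(ν t) = 0
  c2 : ∀ t, ∫ z, z.2 ∂(ν t) = 0

section
variable {d : ℕ} {lw lx lv φM : ℝ} {φ : ℝ → ℝ} {ν : ℝ → Measure (Phase d)}

lemma HS.int {E : Type*} [NormedAddCommGroup E] (H : HS lw lx lv φM φ ν) (t : ℝ) {f : Phase d → E} (hf : Continuous f) :
    Integrable f (ν t) := by
  have := H.prob t
  exact integrable_of_cpt (H.cpt t) hf

lemma HS.int2 {E : Type*} [NormedAddCommGroup E] (H : HS lw lx lv φM φ ν) (t s : ℝ) {f : Phase d × Phase d → E} (hf : Continuous f) :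
    Integrable f ((ν t).prod (ν s)) := by
  have := H.prob t
  have := H.prob s
  exact integrable_of_cpt (prod_cpt (H.cpt t) (H.cpt s)) hf

/-- cutoff -/
def bump0 (d : ℕ) : ContDiffBump (0 : Phase d) := ⟨1, 2, by norm_num, by norm_num⟩

def cut {d : ℕ} (n : ℕ) (z : Phase d) : ℝ := bump0 d (((n : ℝ) + 1)⁻¹ • z)

lemma cut_contDiff (n : ℕ) : ContDiff ℝ 1 (cut n : Phase d → ℝ) := by
  unfold cut
  exact (bump0 d).contDiff.comp (contDiff_const_smul _)

lemma cut_cpt (n : ℕ) : HasCompactSupport (cut n : Phase d → ℝ) := by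
  have h : (((n : ℝ) + 1)⁻¹) ≠ 0 := by positivity
  exact (bump0 d).hasCompactSupport.comp_homeomorph (Homeomorph.smulOfNeZero _ h)

lemma cut_nonneg (n : ℕ) (z : Phase d) : 0 ≤ cut n z := (bump0 d).nonneg
lemma cut_le_one (n : ℕ) (z : Phase d) : cut n z ≤ 1 := (bump0 d).le_one

lemma cut_eq_one (z : Phase d) : ∀ᶠ n : ℕ in atTop, ∀ᶠ y in 𝓝 z, cut n y = 1 := by
  filter_upwards [eventually_ge_atTop (Nat.ceil (‖z‖ + 1))] with n hn
  have hn' : ‖z‖ + 1 ≤ n := (Nat.le_ceil _).trans (by exact_mod_cast hn)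
  filter_upwards [Metric.ball_mem_nhds z one_pos] with y hy
  apply (bump0 d).one_of_mem_closedBall
  simp only [mem_closedBall_zero_iff, norm_smul, bump0]
  have : ‖y‖ ≤ ‖z‖ + 1 := by
    have h := norm_le_norm_add_norm_sub z y
    rw [mem_ball_iff_norm'] at hy
    linarith
  rw [norm_inv, Real.norm_of_nonneg (by positivity)]
  rw [inv_mul_le_iff₀ (by positivity)]
  linarith

lemma cut_fderiv_bound (d : ℕ) : ∃ K : ℝ, 0 ≤ K ∧ ∀ (n : ℕ) (z : Phase d),
    (1 + ‖z‖) * ‖fderiv ℝ (cut n) z‖ ≤ K := by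
  have hc : Continuous (fun z : Phase d => (1 + ‖z‖) * ‖fderiv ℝ (bump0 d) z‖) := by
    have : Continuous (fderiv ℝ (bump0 d)) := ((bump0 d).contDiff (n := 1)).continuous_fderiv (by norm_num)
    fun_prop
  have hs : HasCompactSupport (fun z : Phase d => (1 + ‖z‖) * ‖fderiv ℝ (bump0 d) z‖) := by
    have := ((bump0 d).hasCompactSupport.fderiv (𝕜 := ℝ)).norm
    exact this.mul_left
  obtain ⟨K, hK⟩ := hs.exists_bound_of_continuous hc
  refine ⟨K, (norm_nonneg _).trans (hK 0), fun n z => ?_⟩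
  have e : fderiv ℝ (cut n) z = ((n : ℝ) + 1)⁻¹ • fderiv ℝ (bump0 d) (((n : ℝ) + 1)⁻¹ • z) := by
    unfold cut
    exact fderiv_comp_smul _
  have h1 := hK (((n : ℝ) + 1)⁻¹ • z)
  rw [Real.norm_of_nonneg (by positivity)] at h1
  refine le_trans ?_ h1
  rw [e, norm_smul, norm_smul, norm_inv, Real.norm_of_nonneg (by positivity : 0 ≤ (n : ℝ) + 1), ← mul_assoc]
  gcongr
  have : ((n : ℝ) + 1)⁻¹ ≤ 1 := inv_le_one_of_one_le₀ (by simp)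
  nlinarith [norm_nonneg z]

lemma HS.cont_cpt (H : HS lw lx lv φM φ ν) {f : Phase d → ℝ} (hf : Continuous f) (hs : HasCompactSupport f) :
    Continuous (fun t => ∫ z, f z ∂(ν t)) :=
  H.vague ⟨⟨f, hf⟩, hs.is_zero_at_infty⟩

lemma HS.lsc (H : HS lw lx lv φM φ ν) {f : Phase d → ℝ} (hf : Continuous f) (h0 : ∀ z, 0 ≤ f z) :
    LowerSemicontinuous (fun t => ∫ z, f z ∂(ν t)) := by
  have hcc : ∀ n, Continuous (cut n : Phase d → ℝ) := fun n => (cut_contDiff n).continuous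
  refine lsc_of_approx _ (fun n t => ∫ z, cut n z * f z ∂(ν t)) (fun n => H.cont_cpt (by fun_prop) ((cut_cpt n).mul_right)) ?_ ?_
  · intro n t
    refine integral_mono (H.int t (by fun_prop)) (H.int t hf) fun z => ?_
    have := cut_le_one n z
    have := h0 z
    simp only
    nlinarith
  · intro t
    refine tendsto_integral_of_dominated_convergence f (fun n => (H.int t (by fun_prop)).aestronglyMeasurable) (H.int t hf) ?_ ?_
    · intro n
      refine ae_of_all _ fun z => ?_
      have := cut_le_one n z
      have := cut_nonneg n z
      have := h0 z
      rw [Real.norm_of_nonneg (by positivity)]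
      nlinarith
    · refine ae_of_all _ fun z => ?_
      apply tendsto_const_nhds.congr'
      filter_upwards [cut_eq_one z] with n hn
      rw [hn.self_of_nhds, one_mul]

lemma HS.cont_dom (H : HS lw lx lv φM φ ν) {f q : Phase d → ℝ} (hf : Continuous f) (hq : Continuous q)
    (hfq : ∀ z, |f z| ≤ q z) (hc : Continuous (fun t => ∫ z, q z ∂(ν t))) :
    Continuous (fun t => ∫ z, f z ∂(ν t)) := by
  refine cont_of_lsc _ _ hc ?_ ?_
  · have := H.lsc (f := fun z => q z - f z) (by fun_prop) (fun z => by have := abs_le.1 (hfq z); linarith)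
    convert this using 2 with t
    rw [integral_sub (H.int t hq) (H.int t hf)]
  · have := H.lsc (f := fun z => q z + f z) (by fun_prop) (fun z => by have := abs_le.1 (hfq z); linarith)
    convert this using 2 with t
    rw [integral_add (H.int t hq) (H.int t hf)]

lemma HS.cont_bdd (H : HS lw lx lv φM φ ν) {f : Phase d → ℝ} (hf : Continuous f) (C : ℝ)
    (hfq : ∀ z, |f z| ≤ C) :
    Continuous (fun t => ∫ z, f z ∂(ν t)) := by
  refine H.cont_dom hf continuous_const hfq ?_
  have := H.prob
  simp only [integral_const, probReal_univ, one_smul]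
  fun_prop

def HS.pm (H : HS lw lx lv φM φ ν) (t : ℝ) : ProbabilityMeasure (Phase d) := ⟨ν t, H.prob t⟩

lemma HS.pm_cont (H : HS lw lx lv φM φ ν) : Continuous H.pm := by
  rw [continuous_iff_continuousAt]
  intro t
  rw [ContinuousAt, ProbabilityMeasure.tendsto_iff_forall_integral_tendsto]
  intro f
  exact (H.cont_bdd f.continuous ‖f‖ (fun z => f.norm_coe_le_norm z)).continuousAt

lemma HS.cont_bdd2 (H : HS lw lx lv φM φ ν) {f : Phase d × Phase d → ℝ} (hf : Continuous f) (C : ℝ)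
    (hfq : ∀ z, |f z| ≤ C) :
    Continuous (fun p : ℝ × ℝ => ∫ z, f z ∂((ν p.1).prod (ν p.2))) := by
  have h := ProbabilityMeasure.continuous_prod (α := Phase d) (β := Phase d)
  have h2 : Continuous (fun p : ℝ × ℝ => (H.pm p.1).prod (H.pm p.2)) :=
    h.comp ((H.pm_cont.comp continuous_fst).prodMk (H.pm_cont.comp continuous_snd))
  rw [continuous_iff_continuousAt] at h2 ⊢
  intro p
  have h3 := h2 p
  rw [ContinuousAt, ProbabilityMeasure.tendsto_iff_forall_integral_tendsto] at h3
  exact h3 (BoundedContinuousFunction.ofNormedAddCommGroup f hf C hfq)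

lemma HS.lsc2 (H : HS lw lx lv φM φ ν) {f : Phase d × Phase d → ℝ} (hf : Continuous f) (h0 : ∀ z, 0 ≤ f z) :
    LowerSemicontinuous (fun p : ℝ × ℝ => ∫ z, f z ∂((ν p.1).prod (ν p.2))) := by
  refine lsc_of_approx _ (fun n p => ∫ z, min (f z) n ∂((ν p.1).prod (ν p.2)))
    (fun n => H.cont_bdd2 (by fun_prop) n ?_) ?_ ?_
  · intro z
    rw [abs_of_nonneg (le_min (h0 z) (by positivity))]
    exact min_le_right _ _
  · intro n t
    refine integral_mono (H.int2 _ _ (by fun_prop)) (H.int2 _ _ hf) fun z => min_le_left _ _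
  · intro t
    refine tendsto_integral_of_dominated_convergence f (fun n => (H.int2 _ _ (by fun_prop)).aestronglyMeasurable) (H.int2 _ _ hf) ?_ ?_
    · intro n
      refine ae_of_all _ fun z => ?_
      rw [Real.norm_of_nonneg (le_min (h0 z) (by positivity))]
      exact min_le_left _ _
    · refine ae_of_all _ fun z => ?_
      apply tendsto_const_nhds.congr'
      filter_upwards [eventually_ge_atTop (Nat.ceil (f z))] with n hn
      rw [min_eq_left ((Nat.le_ceil _).trans (by exact_mod_cast hn))]

lemma HS.cont_dom2 (H : HS lw lx lv φM φ ν) {f q : Phase d × Phase d → ℝ} (hf : Continuous f) (hq : Continuous q)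
    (hfq : ∀ z, |f z| ≤ q z) (hc : Continuous (fun p : ℝ × ℝ => ∫ z, q z ∂((ν p.1).prod (ν p.2)))) :
    Continuous (fun p : ℝ × ℝ => ∫ z, f z ∂((ν p.1).prod (ν p.2))) := by
  refine cont_of_lsc _ _ hc ?_ ?_
  · have := H.lsc2 (f := fun z => q z - f z) (by fun_prop) (fun z => by have := abs_le.1 (hfq z); linarith)
    convert this using 2 with t
    rw [integral_sub (H.int2 _ _ hq) (H.int2 _ _ hf)]
  · have := H.lsc2 (f := fun z => q z + f z) (by fun_prop) (fun z => by have := abs_le.1 (hfq z); linarith)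
    convert this using 2 with t
    rw [integral_add (H.int2 _ _ hq) (H.int2 _ _ hf)]

lemma Nn_cont : Continuous (Nn : Phase d → ℝ) := by unfold Nn; fun_prop
lemma Nn_nonneg (z : Phase d) : 0 ≤ Nn z := by unfold Nn; positivity
lemma norm_sq_le_Nn (z : Phase d) : ‖z‖ ^ 2 ≤ Nn z := by
  unfold Nn
  rcases max_choice ‖z.1‖ ‖z.2‖ with h | h <;> rw [Prod.norm_def, h] <;> nlinarith [sq_nonneg ‖z.1‖, sq_nonneg ‖z.2‖]
lemma Nn_le (z : Phase d) : Nn z ≤ 2 * ‖z‖ ^ 2 := by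
  unfold Nn
  have h1 := norm_fst_le z
  have h2 := norm_snd_le z
  nlinarith [norm_nonneg z.1, norm_nonneg z.2]

lemma HS.cont_quad2 (H : HS lw lx lv φM φ ν) (hm : Continuous (fun t => ∫ z, Nn z ∂(ν t)))
    {f : Phase d × Phase d → ℝ} (hf : Continuous f) (C : ℝ)
    (hfq : ∀ z, |f z| ≤ C * (1 + Nn z.1 + Nn z.2)) :
    Continuous (fun p : ℝ × ℝ => ∫ z, f z ∂((ν p.1).prod (ν p.2))) := by
  have hN := @Nn_cont d
  refine H.cont_dom2 hf (by fun_prop) hfq ?_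
  have e : (fun p : ℝ × ℝ => ∫ z, C * (1 + Nn z.1 + Nn z.2) ∂((ν p.1).prod (ν p.2))) =
     fun p => C * (1 + ∫ z, Nn z ∂(ν p.1) + ∫ z, Nn z ∂(ν p.2)) := by
    funext p
    have := H.prob p.1
    have := H.prob p.2
    rw [integral_const_mul, integral_add (H.int2 _ _ (by fun_prop)) (H.int2 _ _ (by fun_prop)),
      integral_add (H.int2 _ _ (by fun_prop)) (H.int2 _ _ (by fun_prop)),
      integral_fun_fst, integral_fun_snd]
    simp
  rw [e]
  exact continuous_const.mul ((continuous_const.add (hm.comp continuous_fst)).add (hm.comp continuous_snd))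

end

section
variable {d : ℕ} {lw lx lv φM : ℝ} {φ : ℝ → ℝ} {ν : ℝ → Measure (Phase d)}

lemma qk_cont (hφ : Continuous φ) : Continuous (fun p : Phase d × Phase d => qk lw lx lv φ p.1 p.2) := by
  unfold qk; fun_prop

lemma HS.qk_bound (H : HS lw lx lv φM φ ν) (z w : Phase d) :
    ‖qk lw lx lv φ z w‖ ≤ (lw + lx * φM + lv * φM) * (‖z‖ + ‖w‖) := by
  have h1 : ‖w.1 - z.1‖ ≤ ‖z‖ + ‖w‖ := by
    have := norm_sub_le w.1 z.1
    linarith [norm_fst_le z, norm_fst_le w]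
  have h2 : ‖w.2 - z.2‖ ≤ ‖z‖ + ‖w‖ := by
    have := norm_sub_le w.2 z.2
    linarith [norm_snd_le z, norm_snd_le w]
  have p0 := H.φ0 ‖z.1 - w.1‖
  have pM := H.φM ‖z.1 - w.1‖
  have := H.lw0
  have := H.lx0
  have := H.lv0
  have hM : 0 ≤ φM := p0.trans pM
  have hM1 : 0 ≤ lx * φM := by positivity
  have hM2 : 0 ≤ lv * φM := by positivity
  unfold qk
  refine (norm_add₃_le).trans ?_
  rw [norm_smul, norm_smul, norm_smul, Real.norm_of_nonneg (by positivity), Real.norm_of_nonneg (by positivity), Real.norm_of_nonneg (by positivity)]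
  have e1 : lw * ‖w.1 - z.1‖ ≤ lw * (‖z‖ + ‖w‖) := by gcongr
  have e2 : lx * φ ‖z.1 - w.1‖ * ‖w.1 - z.1‖ ≤ lx * φM * (‖z‖ + ‖w‖) := by gcongr
  have e3 : lv * φ ‖z.1 - w.1‖ * ‖w.2 - z.2‖ ≤ lv * φM * (‖z‖ + ‖w‖) := by gcongr
  linarith

lemma HS.φM0 (H : HS lw lx lv φM φ ν) : 0 ≤ φM := (H.φ0 0).trans (H.φM 0)

def Cq (lw lx lv φM : ℝ) : ℝ := 1 + (lw + lx * φM + lv * φM)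

lemma HS.Cq0 (H : HS lw lx lv φM φ ν) : 1 ≤ Cq lw lx lv φM := by
  have := H.lw0
  have := H.lx0
  have := H.lv0
  have := H.φM0
  have : 0 ≤ lw + lx * φM + lv * φM := by positivity
  unfold Cq; linarith

lemma HS.pair_bound (H : HS lw lx lv φM φ ν) (z w : Phase d) :
    ‖(z.2, qk lw lx lv φ z w)‖ ≤ Cq lw lx lv φM * (‖z‖ + ‖w‖) := by
  have h := H.qk_bound z w
  have h0 := H.Cq0
  rw [Prod.norm_def]
  refine max_le ?_ ?_
  · have := norm_snd_le z
    simp only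
    nlinarith [norm_nonneg z, norm_nonneg w]
  · refine h.trans ?_
    unfold Cq
    nlinarith [norm_nonneg z, norm_nonneg w]

def Gk (lw lx lv : ℝ) (φ : ℝ → ℝ) (h : Phase d → ℝ) (p : Phase d × Phase d) : ℝ :=
  (fderiv ℝ h p.1) (p.1.2, qk lw lx lv φ p.1 p.2)

lemma Gk_cont (hφ : Continuous φ) {h : Phase d → ℝ} (hh : ContDiff ℝ 1 h) : Continuous (Gk lw lx lv φ h) := by
  have h1 : Continuous (fderiv ℝ h) := hh.continuous_fderiv (by norm_num)
  have h2 := @qk_cont d lw lx lv φ hφ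
  unfold Gk
  fun_prop

lemma HS.Fop_eq (H : HS lw lx lv φM φ ν) {h : Phase d → ℝ} (hh : ContDiff ℝ 1 h) (s : ℝ) :
    Fop lw lx lv φ ν h s = ∫ p, Gk lw lx lv φ h p ∂((ν s).prod (ν s)) := by
  have := H.prob s
  rw [integral_prod _ (H.int2 s s (Gk_cont H.cφ hh))]
  rfl

lemma HS.Gk_bound (H : HS lw lx lv φM φ ν) {h : Phase d → ℝ} {A : ℝ} (hA : 0 ≤ A)
    (hB : ∀ z, ‖fderiv ℝ h z‖ ≤ A * (1 + ‖z‖)) (p : Phase d × Phase d) :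
    ‖Gk lw lx lv φ h p‖ ≤ (2 * A * Cq lw lx lv φM) * (1 + Nn p.1 + Nn p.2) := by
  have h1 := H.pair_bound p.1 p.2
  have h0 := H.Cq0
  have h2 := hB p.1
  unfold Gk
  refine (ContinuousLinearMap.le_opNorm _ _).trans ?_
  calc _ ≤ (A * (1 + ‖p.1‖)) * (Cq lw lx lv φM * (‖p.1‖ + ‖p.2‖)) := by gcongr
    _ = (A * Cq lw lx lv φM) * ((1 + ‖p.1‖) * (‖p.1‖ + ‖p.2‖)) := by ring
    _ ≤ (A * Cq lw lx lv φM) * (2 * (1 + Nn p.1 + Nn p.2)) := by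
      refine mul_le_mul_of_nonneg_left ?_ (by positivity)
      have := norm_sq_le_Nn p.1
      have := norm_sq_le_Nn p.2
      nlinarith [sq_nonneg (‖p.1‖ - 1), sq_nonneg (‖p.2‖ - 1), sq_nonneg (‖p.1‖ - ‖p.2‖)]
    _ = _ := by ring

lemma HS.int_quad (H : HS lw lx lv φM φ ν) (C s : ℝ) :
    ∫ z, C * (1 + Nn z.1 + Nn z.2) ∂((ν s).prod (ν s)) = C * (1 + 2 * ∫ z, Nn z ∂(ν s)) := by
  have := H.prob s
  have hN := @Nn_cont d
  rw [integral_const_mul, integral_add (H.int2 _ _ (by fun_prop)) (H.int2 _ _ (by fun_prop)),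
      integral_add (H.int2 _ _ (by fun_prop)) (H.int2 _ _ (by fun_prop)),
      integral_fun_fst, integral_fun_snd]
  simp
  left; ring

lemma HS.Fop_bound (H : HS lw lx lv φM φ ν) {h : Phase d → ℝ} (hh : ContDiff ℝ 1 h) {A : ℝ} (hA : 0 ≤ A)
    (hB : ∀ z, ‖fderiv ℝ h z‖ ≤ A * (1 + ‖z‖)) (s : ℝ) :
    ‖Fop lw lx lv φ ν h s‖ ≤ (2 * A * Cq lw lx lv φM) * (1 + 2 * ∫ z, Nn z ∂(ν s)) := by
  have hN := @Nn_cont d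
  rw [H.Fop_eq hh, ← H.int_quad]
  exact norm_integral_le_of_norm_le (H.int2 _ _ (by fun_prop)) (ae_of_all _ (H.Gk_bound hA hB))

lemma HS.ewf (H : HS lw lx lv φM φ ν) {h : Phase d → ℝ} (hh : ContDiff ℝ 1 h) {A : ℝ} (hA : 0 ≤ A)
    (hA' : ∀ z, |h z| ≤ A * (1 + ‖z‖) ^ 2)
    (hB : ∀ z, ‖fderiv ℝ h z‖ ≤ A * (1 + ‖z‖)) {a b S : ℝ} (ha : 0 ≤ a) (hab : a ≤ b)
    (hS : ∀ t ∈ Icc a b, ∫ z, Nn z ∂(ν t) ≤ S) :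
    IntervalIntegrable (Fop lw lx lv φ ν h) volume a b ∧
    ∫ z, h z ∂(ν b) - ∫ z, h z ∂(ν a) = ∫ s in a..b, Fop lw lx lv φ ν h s := by
  obtain ⟨K, hK0, hK⟩ := cut_fderiv_bound d
  set hn : ℕ → Phase d → ℝ := fun n z => cut n z * h z with hn_def
  have hcc : ∀ n, Continuous (cut n : Phase d → ℝ) := fun n => (cut_contDiff n).continuous
  have hhc := hh.continuous
  have hn1 : ∀ n, ContDiff ℝ 1 (hn n) := fun n => (cut_contDiff n).mul hh
  have hn2 : ∀ n, HasCompactSupport (hn n) := fun n => (cut_cpt n).mul_right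
  have hnB : ∀ n z, ‖fderiv ℝ (hn n) z‖ ≤ (A * (1 + K)) * (1 + ‖z‖) := by
    intro n z
    have e : fderiv ℝ (hn n) z = cut n z • fderiv ℝ h z + h z • fderiv ℝ (cut n) z :=
      fderiv_fun_mul ((cut_contDiff n).differentiable (by norm_num) z) (hh.differentiable (by norm_num) z)
    rw [e]
    refine (norm_add_le _ _).trans ?_
    rw [norm_smul, norm_smul, Real.norm_of_nonneg (cut_nonneg n z), Real.norm_eq_abs]
    have e1 : cut n z * ‖fderiv ℝ h z‖ ≤ 1 * (A * (1 + ‖z‖)) := by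
      have := cut_le_one n z
      have := hB z
      gcongr
    have e2 : |h z| * ‖fderiv ℝ (cut n) z‖ ≤ A * (1 + ‖z‖) * K := by
      calc _ ≤ A * (1 + ‖z‖) ^ 2 * ‖fderiv ℝ (cut n) z‖ := by gcongr; exact hA' z
        _ = A * (1 + ‖z‖) * ((1 + ‖z‖) * ‖fderiv ℝ (cut n) z‖) := by ring
        _ ≤ _ := by gcongr; exact hK n z
    linarith
  have hAK : 0 ≤ A * (1 + K) := by positivity
  have hC := H.Cq0
  have hev : ∀ z, ∀ᶠ n in atTop, hn n =ᶠ[𝓝 z] h := by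
    intro z
    filter_upwards [cut_eq_one z] with n hn
    filter_upwards [hn] with y hy
    simp [hn_def, hy]
  have hN := @Nn_cont d
  have lim1 : ∀ s, Tendsto (fun n => Fop lw lx lv φ ν (hn n) s) atTop (𝓝 (Fop lw lx lv φ ν h s)) := by
    intro s
    simp_rw [H.Fop_eq (hn1 _), H.Fop_eq hh]
    refine tendsto_integral_of_dominated_convergence
      (fun p => (2 * (A * (1 + K)) * Cq lw lx lv φM) * (1 + Nn p.1 + Nn p.2))
      (fun n => (H.int2 _ _ (Gk_cont H.cφ (hn1 n))).aestronglyMeasurable) (H.int2 _ _ (by fun_prop))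
      (fun n => ae_of_all _ (H.Gk_bound hAK (hnB n))) (ae_of_all _ fun p => ?_)
    apply tendsto_const_nhds.congr'
    filter_upwards [hev p.1] with n hn
    unfold Gk
    rw [hn.fderiv_eq]
  have lim0 : ∀ t, Tendsto (fun n => ∫ z, hn n z ∂(ν t)) atTop (𝓝 (∫ z, h z ∂(ν t))) := by
    intro t
    refine tendsto_integral_of_dominated_convergence (fun z => |h z|)
      (fun n => (H.int _ (hn1 n).continuous).aestronglyMeasurable) (H.int _ (by fun_prop))
      (fun n => ae_of_all _ fun z => ?_) (ae_of_all _ fun z => ?_)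
    · simp only [hn_def, norm_mul, Real.norm_eq_abs]
      rw [abs_of_nonneg (cut_nonneg n z)]
      have := cut_le_one n z
      nlinarith [abs_nonneg (h z)]
    · apply tendsto_const_nhds.congr'
      filter_upwards [hev z] with n hn
      exact hn.self_of_nhds.symm
  set B : ℝ := (2 * (A * (1 + K)) * Cq lw lx lv φM) * (1 + 2 * S) with hBdef
  have bd : ∀ n, ∀ s ∈ Icc a b, ‖Fop lw lx lv φ ν (hn n) s‖ ≤ B := by
    intro n s hs
    refine (H.Fop_bound (hn1 n) hAK (hnB n) s).trans ?_
    rw [hBdef]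
    gcongr
    exact hS s hs
  have bd' : ∀ s ∈ Icc a b, ‖Fop lw lx lv φ ν h s‖ ≤ B := fun s hs =>
    le_of_tendsto (lim1 s).norm (Eventually.of_forall fun n => bd n s hs)
  have sub : Set.uIoc a b ⊆ Icc a b := by rw [uIoc_of_le hab]; exact Ioc_subset_Icc_self
  have meas : ∀ n, AEStronglyMeasurable (Fop lw lx lv φ ν (hn n)) (volume.restrict (Set.uIoc a b)) := by
    intro n
    have := (H.weak _ (hn1 n) (hn2 n) a b ha hab).1
    exact (intervalIntegrable_iff.1 this).aestronglyMeasurable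
  constructor
  · rw [intervalIntegrable_iff]
    have m := aestronglyMeasurable_of_tendsto_ae atTop meas (ae_of_all _ lim1)
    have : IsFiniteMeasure (volume.restrict (Set.uIoc a b)) := ⟨by simp [uIoc]⟩
    refine Integrable.of_bound m B ?_
    filter_upwards [ae_restrict_mem measurableSet_uIoc] with s hs using bd' s (sub hs)
  · have l2 := intervalIntegral.tendsto_integral_filter_of_dominated_convergence (a := a) (b := b) (μ := volume)
      (F := fun n s => Fop lw lx lv φ ν (hn n) s) (l := atTop) (f := Fop lw lx lv φ ν h) (fun _ => B)
      (Eventually.of_forall meas) (Eventually.of_forall fun n => ae_of_all _ fun s hs => bd n s (sub hs))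
      (by simp) (ae_of_all _ fun s _ => lim1 s)
    refine tendsto_nhds_unique ?_ l2
    refine ((lim0 b).sub (lim0 a)).congr fun n => ?_
    exact (H.weak _ (hn1 n) (hn2 n) a b ha hab).2
end


lemma bdd_step {m : ℝ → ℝ} {C : ℝ} (hC0 : 0 < C)
    (hC : ∀ a b S, (∀ t ∈ uIcc a b, m t ≤ S) → |m b - m a| ≤ C * (1 + 2 * S) * |b - a|)
    {a b S0 : ℝ} (hab : |b - a| ≤ 1 / (4 * C)) (h0 : ∀ t ∈ uIcc a b, m t ≤ S0) (hm : ∀ t, 0 ≤ m t) :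
    ∀ u ∈ uIcc a b, ∀ v ∈ uIcc a b, m u ≤ 2 * m v + 1 := by
  have hbd : BddAbove (m '' uIcc a b) := ⟨S0, by rintro _ ⟨t, ht, rfl⟩; exact h0 t ht⟩
  set S := sSup (m '' uIcc a b)
  have hS : ∀ t ∈ uIcc a b, m t ≤ S := fun t ht => le_csSup hbd ⟨t, ht, rfl⟩
  have hS0 : 0 ≤ S := (hm a).trans (hS a left_mem_uIcc)
  have key : ∀ u ∈ uIcc a b, ∀ v ∈ uIcc a b, m u ≤ m v + (1 / 4 + S / 2) := by
    intro u hu v hv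
    have h1 := hC v u S (fun t ht => hS t (uIcc_subset_uIcc hv hu ht))
    have h2 : |u - v| ≤ 1 / (4 * C) := (abs_sub_le_of_uIcc_subset_uIcc (uIcc_subset_uIcc hv hu)).trans hab
    have h3 : C * (1 + 2 * S) * |u - v| ≤ C * (1 + 2 * S) * (1 / (4 * C)) := by gcongr
    have h4 : C * (1 + 2 * S) * (1 / (4 * C)) = 1 / 4 + S / 2 := by field_simp; ring
    linarith [le_abs_self (m u - m v)]
  intro u hu v hv
  have : S ≤ m v + (1 / 4 + S / 2) := by
    refine csSup_le ⟨_, a, left_mem_uIcc, rfl⟩ ?_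
    rintro _ ⟨t, ht, rfl⟩
    exact key t ht v hv
  have := hS u hu
  linarith

lemma cont_of_baire {m : ℝ → ℝ} {C : ℝ} (hC0 : 0 < C) (hm : ∀ t, 0 ≤ m t) (hl : LowerSemicontinuous m)
    (hC : ∀ a b S, (∀ t ∈ uIcc a b, m t ≤ S) → |m b - m a| ≤ C * (1 + 2 * S) * |b - a|) :
    Continuous m := by
  set G : Set ℝ := {t | ∃ S, ∀ᶠ u in 𝓝 t, m u ≤ S} with hG
  have hGo : IsOpen G := by
    rw [isOpen_iff_mem_nhds]
    rintro t ⟨S, hS⟩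
    filter_upwards [eventually_eventually_nhds.2 hS] with u hu using ⟨S, hu⟩
  have hcomp : ∀ K : Set ℝ, IsCompact K → K ⊆ G → ∃ S, ∀ t ∈ K, m t ≤ S := by
    intro K hK hKG
    refine hK.induction_on (p := fun s => ∃ S, ∀ t ∈ s, m t ≤ S) ⟨0, by simp⟩ ?_ ?_ ?_
    · rintro s t hst ⟨S, hS⟩
      exact ⟨S, fun u hu => hS u (hst hu)⟩
    · rintro s t ⟨S, hS⟩ ⟨S', hS'⟩
      refine ⟨max S S', ?_⟩
      rintro u (hu | hu)
      · exact (hS u hu).trans (le_max_left _ _)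
      · exact (hS' u hu).trans (le_max_right _ _)
    · intro t ht
      obtain ⟨S, hS⟩ := hKG ht
      exact ⟨{u | m u ≤ S}, mem_nhdsWithin_of_mem_nhds hS, S, fun u hu => hu⟩
  have hall : ∀ t, t ∈ G := by
    by_contra! hne
    obtain ⟨t0, ht0⟩ := hne
    have hBc : IsClosed Gᶜ := hGo.isClosed_compl
    have : CompleteSpace (Gᶜ : Set ℝ) := hBc.completeSpace_coe
    have : Nonempty (Gᶜ : Set ℝ) := ⟨⟨t0, ht0⟩⟩
    obtain ⟨N, ⟨p, hpB⟩, hp⟩ := nonempty_interior_of_iUnion_of_closed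
      (X := (Gᶜ : Set ℝ)) (f := fun n : ℕ => {t : (Gᶜ : Set ℝ) | m t ≤ n})
      (fun n => (hl.isClosed_preimage n).preimage continuous_subtype_val)
      (by
        rw [eq_univ_iff_forall]
        intro t
        obtain ⟨n, hn⟩ := exists_nat_ge (m t)
        exact mem_iUnion.2 ⟨n, hn⟩)
    rw [mem_interior_iff_mem_nhds, Metric.mem_nhds_iff] at hp
    obtain ⟨r, hr, hrN⟩ := hp
    apply hpB
    refine ⟨2 * N + 1, ?_⟩
    filter_upwards [Metric.ball_mem_nhds p (lt_min hr (by positivity : 0 < 1 / (4 * C)))] with t ht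
    rw [Metric.mem_ball, Real.dist_eq] at ht
    -- nearest bad point
    obtain ⟨a, ⟨haB, hapt⟩, hamin⟩ := (isCompact_uIcc.inter_left hBc : IsCompact (Gᶜ ∩ uIcc p t)).exists_isMinOn
      ⟨p, hpB, left_mem_uIcc⟩ (f := fun u => |u - t|) (by fun_prop)
    have hap : |a - p| < r := by
      have := abs_sub_left_of_mem_uIcc hapt
      exact this.trans_lt (ht.trans_le (min_le_left _ _))
    have haN : m a ≤ N := hrN (a := ⟨a, haB⟩) (by simpa [Subtype.dist_eq, Real.dist_eq] using hap)
    have hsub : uIcc a t ⊆ uIcc p t := uIcc_subset_uIcc hapt right_mem_uIcc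
    have hat : |t - a| ≤ 1 / (4 * C) := by
      have := abs_sub_right_of_mem_uIcc hapt
      exact this.trans (ht.le.trans (min_le_right _ _))
    have hgood : ∀ u ∈ uIcc a t, u ≠ a → u ∈ G := by
      intro u hu hua
      by_contra hub
      have h1 := hamin ⟨hub, hsub hu⟩
      simp only [mem_ofPred_eq] at h1
      rcases le_total a t with h | h
      · rw [uIcc_of_le h] at hu
        rw [abs_of_nonpos (by linarith), abs_of_nonpos (by linarith [hu.2])] at h1
        exact hua (le_antisymm (by linarith) hu.1)
      · rw [uIcc_of_ge h] at hu
        rw [abs_of_nonneg (by linarith), abs_of_nonneg (by linarith [hu.1])] at h1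
        exact hua (le_antisymm hu.2 (by linarith))
    have hbd : ∀ u ∈ uIcc a t, m u ≤ max (m a) (2 * m t + 1) := by
      intro u hu
      by_cases hua : u = a
      · rw [hua]; exact le_max_left _ _
      · refine le_trans ?_ (le_max_right _ _)
        have hs : uIcc u t ⊆ uIcc a t := uIcc_subset_uIcc hu right_mem_uIcc
        have hsG : uIcc u t ⊆ G := by
          intro y hy
          refine hgood y (hs hy) ?_
          rintro rfl
          -- y = a in uIcc u t, u in uIcc a t
          apply hua
          rcases mem_uIcc.1 hy with h | h <;> rcases mem_uIcc.1 hu with h' | h' <;> 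
            first
            | exact le_antisymm (by linarith) (by linarith)
        obtain ⟨S, hS⟩ := hcomp _ isCompact_uIcc hsG
        refine bdd_step hC0 hC ?_ hS hm u left_mem_uIcc t right_mem_uIcc
        exact (abs_sub_le_of_uIcc_subset_uIcc hs).trans hat
    have := bdd_step hC0 hC hat hbd hm t right_mem_uIcc a left_mem_uIcc
    linarith
  rw [continuous_iff_continuousAt]
  intro t
  obtain ⟨S, hS⟩ := hall t
  obtain ⟨ε, hε, hεS⟩ := Metric.eventually_nhds_iff.1 hS
  rw [ContinuousAt, tendsto_iff_norm_sub_tendsto_zero]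
  have h2 : Tendsto (fun u => C * (1 + 2 * S) * |u - t|) (𝓝 t) (𝓝 0) := by
    have : Continuous (fun u => C * (1 + 2 * S) * |u - t|) := by fun_prop
    simpa using this.tendsto t
  refine squeeze_zero' (Eventually.of_forall fun u => norm_nonneg _) ?_ h2
  filter_upwards [Metric.ball_mem_nhds t hε] with u hu
  refine hC t u S fun y hy => hεS ?_
  rw [Metric.mem_ball, Real.dist_eq] at hu
  rw [Real.dist_eq]
  exact (abs_sub_left_of_mem_uIcc hy).trans_lt hu

section
variable {d : ℕ} {lw lx lv φM : ℝ} {φ : ℝ → ℝ} {ν : ℝ → Measure (Phase d)}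

lemma Nn_contDiff : ContDiff ℝ 1 (Nn : Phase d → ℝ) := by
  unfold Nn
  exact (contDiff_fst.norm_sq ℝ).add (contDiff_snd.norm_sq ℝ)

lemma fderiv_nsq1 (z y : Phase d) : fderiv ℝ (fun z : Phase d => ‖z.1‖ ^ 2) z y = 2 * ⟪z.1, y.1⟫ := by
  have h := (hasFDerivAt_fst (𝕜 := ℝ) (p := z)).norm_sq
  rw [h.fderiv]; simp

lemma fderiv_nsq2 (z y : Phase d) : fderiv ℝ (fun z : Phase d => ‖z.2‖ ^ 2) z y = 2 * ⟪z.2, y.2⟫ := by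
  have h := (hasFDerivAt_snd (𝕜 := ℝ) (p := z)).norm_sq
  rw [h.fderiv]; simp

lemma nsq1_contDiff : ContDiff ℝ 1 (fun z : Phase d => ‖z.1‖ ^ 2) := contDiff_fst.norm_sq ℝ
lemma nsq2_contDiff : ContDiff ℝ 1 (fun z : Phase d => ‖z.2‖ ^ 2) := contDiff_snd.norm_sq ℝ

lemma nsq1_b1 (z : Phase d) : |‖z.1‖ ^ 2| ≤ 4 * (1 + ‖z‖) ^ 2 := by
  rw [abs_of_nonneg (by positivity)]
  have := norm_fst_le z
  nlinarith [norm_nonneg z, norm_nonneg z.1]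
lemma nsq2_b1 (z : Phase d) : |‖z.2‖ ^ 2| ≤ 4 * (1 + ‖z‖) ^ 2 := by
  rw [abs_of_nonneg (by positivity)]
  have := norm_snd_le z
  nlinarith [norm_nonneg z, norm_nonneg z.2]
lemma nsq1_b2 (z : Phase d) : ‖fderiv ℝ (fun z : Phase d => ‖z.1‖ ^ 2) z‖ ≤ 2 * (1 + ‖z‖) := by
  refine ContinuousLinearMap.opNorm_le_bound _ (by positivity) fun y => ?_
  rw [fderiv_nsq1, norm_mul]
  have := norm_inner_le_norm (𝕜 := ℝ) z.1 y.1
  have h1 := norm_fst_le z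
  have h2 := norm_fst_le y
  have h3 : ‖z.1‖ * ‖y.1‖ ≤ (1 + ‖z‖) * ‖y‖ := by gcongr; linarith
  simp only [Real.norm_ofNat]; linarith
lemma nsq2_b2 (z : Phase d) : ‖fderiv ℝ (fun z : Phase d => ‖z.2‖ ^ 2) z‖ ≤ 2 * (1 + ‖z‖) := by
  refine ContinuousLinearMap.opNorm_le_bound _ (by positivity) fun y => ?_
  rw [fderiv_nsq2, norm_mul]
  have := norm_inner_le_norm (𝕜 := ℝ) z.2 y.2
  have h1 := norm_snd_le z
  have h2 := norm_snd_le y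
  have h3 : ‖z.2‖ * ‖y.2‖ ≤ (1 + ‖z‖) * ‖y‖ := by gcongr; linarith
  simp only [Real.norm_ofNat]; linarith
lemma Nn_b1 (z : Phase d) : |Nn z| ≤ 4 * (1 + ‖z‖) ^ 2 := by
  rw [abs_of_nonneg (Nn_nonneg z)]
  have := Nn_le z
  nlinarith [norm_nonneg z]
lemma Nn_b2 (z : Phase d) : ‖fderiv ℝ Nn z‖ ≤ 4 * (1 + ‖z‖) := by
  have e : fderiv ℝ Nn z = fderiv ℝ (fun z : Phase d => ‖z.1‖ ^ 2) z + fderiv ℝ (fun z : Phase d => ‖z.2‖ ^ 2) z :=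
    fderiv_fun_add (nsq1_contDiff.differentiable (by norm_num) z) (nsq2_contDiff.differentiable (by norm_num) z)
  rw [e]
  have := nsq1_b2 z
  have := nsq2_b2 z
  refine (norm_add_le _ _).trans ?_
  linarith

lemma HS.m2_est (H : HS lw lx lv φM φ ν) {a b S : ℝ} (ha : 0 ≤ a) (hab : a ≤ b)
    (hS : ∀ t ∈ Icc a b, ∫ z, Nn z ∂(ν t) ≤ S) :
    |∫ z, Nn z ∂(ν b) - ∫ z, Nn z ∂(ν a)| ≤ (2 * 4 * Cq lw lx lv φM) * (1 + 2 * S) * (b - a) := by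
  have hC := H.Cq0
  rw [(H.ewf Nn_contDiff (by norm_num) Nn_b1 Nn_b2 ha hab hS).2]
  have := intervalIntegral.norm_integral_le_of_norm_le_const (a := a) (b := b) (f := Fop lw lx lv φ ν Nn)
    (C := (2 * 4 * Cq lw lx lv φM) * (1 + 2 * S)) (fun s hs => by
      rw [uIoc_of_le hab] at hs
      refine (H.Fop_bound Nn_contDiff (by norm_num) Nn_b2 s).trans ?_
      gcongr
      exact hS s (Ioc_subset_Icc_self hs))
  rwa [abs_of_nonneg (by linarith : 0 ≤ b - a)] at this

lemma HS.m2_cont (H : HS lw lx lv φM φ ν) : Continuous (fun t => ∫ z, Nn z ∂(ν t)) := by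
  have hC := H.Cq0
  have h0 : ∀ t, 0 ≤ ∫ z, Nn z ∂(ν t) := fun t => integral_nonneg Nn_nonneg
  refine cont_of_baire (C := 2 * 4 * Cq lw lx lv φM) (by linarith) h0
    (H.lsc Nn_cont Nn_nonneg) ?_
  have main : ∀ a b S, a ≤ b → (∀ t ∈ Icc a b, ∫ z, Nn z ∂(ν t) ≤ S) →
      |∫ z, Nn z ∂(ν b) - ∫ z, Nn z ∂(ν a)| ≤ (2 * 4 * Cq lw lx lv φM) * (1 + 2 * S) * |b - a| := by
    intro a b S hab hS
    have hS0 : 0 ≤ S := (h0 a).trans (hS a (left_mem_Icc.2 hab))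
    rcases le_total 0 a with ha | ha
    · rw [abs_of_nonneg (by linarith : 0 ≤ b - a)]
      exact H.m2_est ha hab hS
    · rcases le_total 0 b with hb | hb
      · rw [H.neg a ha]
        refine (H.m2_est le_rfl hb (fun t ht => hS t ⟨ha.trans ht.1, ht.2⟩)).trans ?_
        rw [abs_of_nonneg (by linarith : 0 ≤ b - a)]
        gcongr
      · rw [H.neg a ha, H.neg b hb]
        simp only [sub_self, abs_zero]
        positivity
  intro a b S hS
  rcases le_total a b with h | h
  · rw [uIcc_of_le h] at hS
    exact main a b S h hS
  · rw [uIcc_of_ge h] at hS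
    rw [abs_sub_comm, abs_sub_comm b a]
    exact main b a S h hS
end


section
variable {d : ℕ} {lw lx lv : ℝ} {φ : ℝ → ℝ} {μ : ℝ → Measure (Phase d)}

def tb (T : ℝ) (hT : 0 ≤ T) : ContDiffBump (0 : ℝ) := ⟨T + 1, T + 2, by linarith, by linarith⟩

lemma tb_exists {T : ℝ} (hT : 0 ≤ T) : ∃ χ : ℝ → ℝ, ContDiff ℝ 1 χ ∧ HasCompactSupport χ ∧
    ∀ s ∈ Icc 0 T, χ =ᶠ[𝓝 s] 1 := by
  refine ⟨tb T hT, (tb T hT).contDiff, (tb T hT).hasCompactSupport, ?_⟩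
  intro s hs
  apply (tb T hT).eventuallyEq_one_of_mem_ball
  simp only [Metric.mem_ball, dist_zero_right, Real.norm_eq_abs, tb]
  rw [abs_of_nonneg hs.1]
  linarith [hs.2]

lemma fd_left {h : Phase d → ℝ} (hh : ContDiff ℝ 1 h) (a : ℝ) (z : Phase d) (y : Euc d) :
    (fderiv ℝ (fun y => a * h (y, z.2)) z.1) y = a * fderiv ℝ h z (y, 0) := by
  have hdz := (hh.differentiable (by norm_num) z).hasFDerivAt
  have := (HasFDerivAt.comp (f := fun y : Euc d => (y, z.2)) z.1 hdz (hasFDerivAt_prodMk_left z.1 z.2)).const_mul a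
  have e := this.fderiv
  simp only [Function.comp_def] at e
  rw [e]; simp

lemma fd_right {h : Phase d → ℝ} (hh : ContDiff ℝ 1 h) (a : ℝ) (z : Phase d) (y : Euc d) :
    (fderiv ℝ (fun y => a * h (z.1, y)) z.2) y = a * fderiv ℝ h z (0, y) := by
  have hdz := (hh.differentiable (by norm_num) z).hasFDerivAt
  have := (HasFDerivAt.comp (f := fun y : Euc d => (z.1, y)) z.2 hdz (hasFDerivAt_prodMk_right z.1 z.2)).const_mul a
  have e := this.fderiv
  simp only [Function.comp_def] at e
  rw [e]; simp

lemma Gk_int (hφc : Continuous φ) {ρ : Measure (Phase d)} [IsProbabilityMeasure ρ] (hK : MeasureCompactSupport ρ)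
    (h : Phase d → ℝ) (z : Phase d) :
    ∫ w, Gk lw lx lv φ h (z, w) ∂ρ = fderiv ℝ h z (z.2, 0) + fderiv ℝ h z (0, herdQ lw lx lv φ ρ z.1 z.2) := by
  have hqz : Continuous (fun w => qk lw lx lv φ z w) := by unfold qk; fun_prop
  have i1 : Integrable (fun w => qk lw lx lv φ z w) ρ := integrable_of_cpt hK hqz
  have i2 := ContinuousLinearMap.integral_comp_comm ((fderiv ℝ h z).comp (ContinuousLinearMap.inr ℝ (Euc d) (Euc d))) i1
  have i3 := ContinuousLinearMap.integrable_comp ((fderiv ℝ h z).comp (ContinuousLinearMap.inr ℝ (Euc d) (Euc d))) i1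
  have e : (fun w => Gk lw lx lv φ h (z, w)) = fun w => fderiv ℝ h z (z.2, 0) + ((fderiv ℝ h z).comp (ContinuousLinearMap.inr ℝ (Euc d) (Euc d))) (qk lw lx lv φ z w) := by
    funext w
    simp only [Gk, ContinuousLinearMap.comp_apply, ContinuousLinearMap.inr_apply, ← map_add, Prod.mk_add_mk, add_zero, zero_add]
  rw [e, integral_add (integrable_const _) i3, i2]
  simp [herdQ, qk]

lemma weak_id (hφc : Continuous φ) (hsol : IsMVSol lw lx lv φ (Set.Ici 0) μ)
    (hprob : ∀ t ∈ Set.Ici (0:ℝ), IsProbabilityMeasure (μ t))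
    (hcpt : ∀ t ∈ Set.Ici (0:ℝ), MeasureCompactSupport (μ t))
    {h : Phase d → ℝ} (hh : ContDiff ℝ 1 h) (hs : HasCompactSupport h) (c : ℝ) {T : ℝ} (hT : 0 ≤ T) :
    (1 + c * T) * ∫ z, h z ∂(μ T) - ∫ z, h z ∂(μ 0) =
      ∫ s in (0:ℝ)..T, (c * (∫ z, h z ∂(μ s)) + (1 + c * s) * Fop lw lx lv φ μ h s) := by
  obtain ⟨χ, hχc, hχs, hχ1⟩ := tb_exists hT
  have g1 : ContDiff ℝ 1 (fun p : Phase d × ℝ => χ p.2 * (1 + c * p.2) * h p.1) := by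
    have a1 : ContDiff ℝ 1 (fun p : Phase d × ℝ => χ p.2) := hχc.comp contDiff_snd
    have a2 : ContDiff ℝ 1 (fun p : Phase d × ℝ => h p.1) := hh.comp contDiff_fst
    have a3 : ContDiff ℝ 1 (fun p : Phase d × ℝ => 1 + c * p.2) := by fun_prop
    exact (a1.mul a3).mul a2
  have g2 : HasCompactSupport (fun p : Phase d × ℝ => χ p.2 * (1 + c * p.2) * h p.1) := by
    refine HasCompactSupport.intro (K := tsupport h ×ˢ tsupport χ) (IsCompact.prod hs hχs) ?_
    intro p hp
    by_cases h1 : p.1 ∈ tsupport h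
    · have h2 : p.2 ∉ tsupport χ := fun h2 => hp ⟨h1, h2⟩
      simp [image_eq_zero_of_notMem_tsupport h2]
    · simp [image_eq_zero_of_notMem_tsupport h1]
  have key := hsol.2.2 _ g1 g2 T hT
  simp only at key
  have x0 : χ 0 = 1 := (hχ1 0 ⟨le_rfl, hT⟩).self_of_nhds
  have xT : χ T = 1 := (hχ1 T ⟨hT, le_rfl⟩).self_of_nhds
  rw [x0, xT, integral_const_mul, integral_const_mul] at key
  simp only [one_mul, mul_zero, add_zero] at key
  rw [key]
  refine intervalIntegral.integral_congr fun s hs' => ?_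
  rw [uIcc_of_le hT] at hs'
  have hs0 : s ∈ Ici (0:ℝ) := hs'.1
  have := hprob s hs0
  have hK := hcpt s hs0
  have hχs1 : χ s = 1 := (hχ1 s hs').self_of_nhds
  have d1 : ∀ z, deriv (fun u => χ u * (1 + c * u) * h z) s = c * h z := by
    intro z
    have : (fun u => χ u * (1 + c * u) * h z) =ᶠ[𝓝 s] fun u => (1 + c * u) * h z := by
      filter_upwards [hχ1 s hs'] with u hu
      simp [hu]
    rw [this.deriv_eq]
    have hd : HasDerivAt (fun u : ℝ => (1 + c * u) * h z) (c * 1 * h z) s :=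
      (((hasDerivAt_id s).const_mul c).const_add 1).mul_const (h z)
    rw [hd.deriv]; ring
  have pt : ∀ z : Phase d, (deriv (fun u => χ u * (1 + c * u) * h z) s
          + (fderiv ℝ (fun y => χ s * (1 + c * s) * h (y, z.2)) z.1) z.2
          + (fderiv ℝ (fun w => χ s * (1 + c * s) * h (z.1, w)) z.2)
              (herdQ lw lx lv φ (μ s) z.1 z.2)) =
      c * h z + (1 + c * s) * ∫ w, Gk lw lx lv φ h (z, w) ∂(μ s) := by
    intro z
    rw [d1 z, fd_left hh, fd_right hh, Gk_int hφc hK, hχs1]; ring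
  rw [integral_congr_ae (ae_of_all _ pt)]
  have j1 : Integrable h (μ s) := integrable_of_cpt hK hh.continuous
  have j2 : Integrable (Gk lw lx lv φ h) ((μ s).prod (μ s)) := integrable_of_cpt (prod_cpt hK hK) (Gk_cont hφc hh)
  rw [integral_add (j1.const_mul _) (j2.integral_prod_left.const_mul _), integral_const_mul, integral_const_mul]
  rfl

lemma Fop_lin (hφc : Continuous φ) 
    (hprob : ∀ t ∈ Set.Ici (0:ℝ), IsProbabilityMeasure (μ t))
    (hcpt : ∀ t ∈ Set.Ici (0:ℝ), MeasureCompactSupport (μ t))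
    {h k : Phase d → ℝ} (hh : ContDiff ℝ 1 h) (hk : ContDiff ℝ 1 k) (c : ℝ) {s : ℝ} (hs : 0 ≤ s) :
    Fop lw lx lv φ μ (fun z => c * k z + h z) s = c * Fop lw lx lv φ μ k s + Fop lw lx lv φ μ h s := by
  have := hprob s hs
  have hK := hcpt s hs
  have e : ∀ {h : Phase d → ℝ}, ContDiff ℝ 1 h → Integrable (Gk lw lx lv φ h) ((μ s).prod (μ s)) := fun hh =>
    integrable_of_cpt (prod_cpt hK hK) (Gk_cont hφc hh)
  have e2 : ∀ {h : Phase d → ℝ}, ContDiff ℝ 1 h → Fop lw lx lv φ μ h s = ∫ p, Gk lw lx lv φ h p ∂((μ s).prod (μ s)) := by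
    intro h hh
    rw [integral_prod _ (e hh)]
    rfl
  rw [e2 hh, e2 hk, e2 ((contDiff_const.mul hk).add hh), ← integral_const_mul, ← integral_add ((e hk).const_mul _) (e hh)]
  congr 1; funext p
  unfold Gk
  have hd : HasFDerivAt (fun z => c * k z + h z) (c • fderiv ℝ k p.1 + fderiv ℝ h p.1) p.1 :=
    ((hk.differentiable (by norm_num) p.1).hasFDerivAt.const_mul c).add (hh.differentiable (by norm_num) p.1).hasFDerivAt
  rw [hd.fderiv]; simp

lemma weak_int (hφc : Continuous φ) (hsol : IsMVSol lw lx lv φ (Set.Ici 0) μ)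
    (hprob : ∀ t ∈ Set.Ici (0:ℝ), IsProbabilityMeasure (μ t))
    (hcpt : ∀ t ∈ Set.Ici (0:ℝ), MeasureCompactSupport (μ t))
    {h : Phase d → ℝ} (hh : ContDiff ℝ 1 h) (hs : HasCompactSupport h) {T : ℝ} (hT : 0 ≤ T) :
    IntervalIntegrable (Fop lw lx lv φ μ h) volume 0 T := by
  rcases hT.eq_or_lt with rfl | hT'
  · simp
  -- nonvanishing integral forces integrability
  have A : ∀ k : Phase d → ℝ, ContDiff ℝ 1 k → HasCompactSupport k → ∫ z, k z ∂(μ T) ≠ 0 →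
      IntervalIntegrable (Fop lw lx lv φ μ k) volume 0 T := by
    intro k hk hks hne
    by_contra hni
    have i0 := weak_id hφc hsol hprob hcpt hk hks 0 hT
    have i1 := weak_id hφc hsol hprob hcpt hk hks 1 hT
    simp only [zero_mul, add_zero, one_mul, zero_add] at i0 i1
    rw [intervalIntegral.integral_undef hni] at i0
    have hc : ContinuousOn (fun s => ∫ z, k z ∂(μ s)) (uIcc 0 T) := by
      rw [uIcc_of_le hT]
      exact (hsol.2.1 ⟨⟨k, hk.continuous⟩, hks.is_zero_at_infty⟩).mono (fun s hs => hs.1)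
    have hni2 : ¬ IntervalIntegrable (fun s => (∫ z, k z ∂(μ s)) + (1 + s) * Fop lw lx lv φ μ k s) volume 0 T := by
      intro hi
      have h1 := hi.sub hc.intervalIntegrable
      have h2 : ContinuousOn (fun s : ℝ => (1 + s)⁻¹) (uIcc 0 T) := by
        rw [uIcc_of_le hT]
        refine ContinuousOn.inv₀ (by fun_prop) fun s hs => ?_
        have := hs.1
        positivity
      have h3 := h1.continuousOn_mul h2
      apply hni
      refine h3.congr ?_
      intro s hs
      rw [uIoc_of_le hT] at hs
      have : 1 + s ≠ 0 := by linarith [hs.1]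
      simp only
      field_simp
      ring
    rw [intervalIntegral.integral_undef hni2] at i1
    have : T * ∫ z, k z ∂(μ T) = 0 := by linarith
    rcases mul_eq_zero.1 this with h | h
    · linarith
    · exact hne h
  -- a test function with nonzero integral
  have hp := hprob T hT
  obtain ⟨n, hn⟩ : ∃ n : ℕ, ∫ z, (cut n : Phase d → ℝ) z ∂(μ T) ≠ 0 := by
    have l : Tendsto (fun n : ℕ => ∫ z, (cut n : Phase d → ℝ) z ∂(μ T)) atTop (𝓝 (∫ z : Phase d, (1:ℝ) ∂(μ T))) := by
      refine tendsto_integral_of_dominated_convergence (fun _ => 1) (fun n => (cut_contDiff n).continuous.aestronglyMeasurable)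
        (integrable_const _) (fun n => ae_of_all _ fun z => ?_) (ae_of_all _ fun z => ?_)
      · rw [Real.norm_of_nonneg (cut_nonneg n z)]; exact cut_le_one n z
      · apply tendsto_const_nhds.congr'
        filter_upwards [cut_eq_one z] with n hn using hn.self_of_nhds.symm
    simp only [integral_const, probReal_univ, smul_eq_mul, mul_one] at l
    exact (l.eventually_ne one_ne_zero).exists
  have hk1 := @cut_contDiff d n
  have hk2 := @cut_cpt d n
  have B := A _ hk1 hk2 hn
  by_cases hz : ∫ z, h z ∂(μ T) = 0
  · have C := A (fun z => 1 * cut n z + h z) ((contDiff_const.mul hk1).add hh) (by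
        have : HasCompactSupport (fun z => (1:ℝ) * (cut n : Phase d → ℝ) z) := hk2.mul_left
        exact this.add hs) (by
        have hK := hcpt T hT
        rw [integral_add ((integrable_of_cpt hK hk1.continuous).const_mul 1) (integrable_of_cpt hK hh.continuous), hz]
        simpa using hn)
    refine (C.sub B).congr ?_
    intro s hs
    rw [uIoc_of_le hT] at hs
    simp only [Fop_lin hφc hprob hcpt hh hk1 1 hs.1.le]
    ring
  · exact A h hh hs hz

lemma mkHS {φm φM : ℝ} (hlw : 0 < lw) (hlx : 0 < lx) (hlv : 0 < lv) (hφc : Continuous φ)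
    (hφm : 0 < φm) (hφ : ∀ r, φm ≤ φ r ∧ φ r ≤ φM) (hsol : IsMVSol lw lx lv φ (Set.Ici 0) μ)
    (hprob : ∀ t ∈ Set.Ici (0:ℝ), IsProbabilityMeasure (μ t))
    (hcpt : ∀ t ∈ Set.Ici (0:ℝ), MeasureCompactSupport (μ t))
    (hcent : ∀ t ∈ Set.Ici (0:ℝ), (∫ z, z.1 ∂(μ t)) = 0 ∧ (∫ z, z.2 ∂(μ t)) = 0) :
    HS lw lx lv φM φ (fun t => μ (max t 0)) where
  lw0 := hlw
  lx0 := hlx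
  lv0 := hlv
  cφ := hφc
  φ0 r := hφm.le.trans (hφ r).1
  φM r := (hφ r).2
  prob t := hprob (max t 0) (mem_Ici.2 (le_max_right _ _))
  cpt t := hcpt (max t 0) (mem_Ici.2 (le_max_right _ _))
  vague g := (hsol.2.1 g).comp_continuous (f := fun t => max t 0) (by fun_prop) (fun t => mem_Ici.2 (le_max_right _ _))
  neg t ht := by simp [ht]
  c1 t := (hcent (max t 0) (mem_Ici.2 (le_max_right _ _))).1
  c2 t := (hcent (max t 0) (mem_Ici.2 (le_max_right _ _))).2
  weak h hh hs a b ha hab := by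
    have hb := ha.trans hab
    have ia := weak_int hφc hsol hprob hcpt hh hs ha
    have ib := weak_int hφc hsol hprob hcpt hh hs hb
    have iab := ia.symm.trans ib
    have wa := weak_id hφc hsol hprob hcpt hh hs 0 ha
    have wb := weak_id hφc hsol hprob hcpt hh hs 0 hb
    simp only [zero_mul, add_zero, one_mul, zero_add] at wa wb
    have e : ∀ s, 0 ≤ s → Fop lw lx lv φ (fun t => μ (max t 0)) h s = Fop lw lx lv φ μ h s := by
      intro s hs
      simp only [Fop, max_eq_left hs]
    constructor
    · refine iab.congr fun s hs => ?_
      rw [uIoc_of_le hab] at hs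
      exact (e s (ha.trans hs.1.le)).symm
    · simp only [max_eq_left ha, max_eq_left hb]
      rw [intervalIntegral.integral_congr (g := Fop lw lx lv φ μ h) (fun s hs => by
        rw [uIcc_of_le hab] at hs
        exact e s (ha.trans hs.1))]
      rw [← intervalIntegral.integral_interval_sub_left ib ia]
      linarith
end


section
variable {d : ℕ} {lw lx lv φM : ℝ} {φ : ℝ → ℝ} {ν : ℝ → Measure (Phase d)}

lemma HS.Fop_cont (H : HS lw lx lv φM φ ν) {h : Phase d → ℝ} (hh : ContDiff ℝ 1 h) {A : ℝ} (hA : 0 ≤ A)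
    (hB : ∀ z, ‖fderiv ℝ h z‖ ≤ A * (1 + ‖z‖)) : Continuous (Fop lw lx lv φ ν h) := by
  have h1 := H.cont_quad2 H.m2_cont (Gk_cont (lw := lw) (lx := lx) (lv := lv) H.cφ hh) _ (fun p => by
    simpa only [Real.norm_eq_abs] using H.Gk_bound hA hB p)
  have h2 : Continuous (fun s => ∫ z, Gk lw lx lv φ h z ∂((ν s).prod (ν s))) :=
    h1.comp (f := fun s : ℝ => (s, s)) (by fun_prop)
  refine h2.congr fun s => ?_
  exact (H.Fop_eq hh s).symm

lemma HS.ewf' (H : HS lw lx lv φM φ ν) {h : Phase d → ℝ} (hh : ContDiff ℝ 1 h) {A : ℝ} (hA : 0 ≤ A)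
    (hA' : ∀ z, |h z| ≤ A * (1 + ‖z‖) ^ 2)
    (hB : ∀ z, ‖fderiv ℝ h z‖ ≤ A * (1 + ‖z‖)) {a b : ℝ} (ha : 0 ≤ a) (hab : a ≤ b) :
    ∫ z, h z ∂(ν b) - ∫ z, h z ∂(ν a) = ∫ s in a..b, Fop lw lx lv φ ν h s := by
  obtain ⟨S, hS⟩ := (isCompact_Icc (a := a) (b := b)).bddAbove_image H.m2_cont.continuousOn
  exact (H.ewf hh hA hA' hB ha hab (S := S) (fun t ht => hS ⟨t, ht, rfl⟩)).2

lemma HS.hasDeriv (H : HS lw lx lv φM φ ν) {h : Phase d → ℝ} (hh : ContDiff ℝ 1 h) {A : ℝ} (hA : 0 ≤ A)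
    (hA' : ∀ z, |h z| ≤ A * (1 + ‖z‖) ^ 2)
    (hB : ∀ z, ‖fderiv ℝ h z‖ ≤ A * (1 + ‖z‖)) {t : ℝ} (ht : 0 < t) :
    HasDerivAt (fun u => ∫ z, h z ∂(ν u)) (Fop lw lx lv φ ν h t) t := by
  have hc := H.Fop_cont hh hA hB
  have h1 : HasDerivAt (fun u => ∫ z, h z ∂(ν 0) + ∫ s in (0:ℝ)..u, Fop lw lx lv φ ν h s) (Fop lw lx lv φ ν h t) t :=
    (hc.integral_hasStrictDerivAt 0 t).hasDerivAt.const_add _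
  refine h1.congr_of_eventuallyEq ?_
  filter_upwards [lt_mem_nhds ht] with u hu
  have := H.ewf' hh hA hA' hB le_rfl hu.le
  linarith

/-- potential -/
def pot (φ : ℝ → ℝ) (y : Euc d) : ℝ := Phifun φ ‖y‖

lemma pot_hasFDeriv (hφ : Continuous φ) (y : Euc d) : HasFDerivAt (pot φ) (φ ‖y‖ • innerSL ℝ y) y := by
  have h1 : HasDerivAt (fun u => ∫ s in (0:ℝ)..u, φ (Real.sqrt s)) (φ (Real.sqrt (‖y‖ ^ 2))) (‖y‖ ^ 2) :=
    (Continuous.integral_hasStrictDerivAt (f := fun s => φ (Real.sqrt s)) (by fun_prop) 0 _).hasDerivAt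
  rw [Real.sqrt_sq (norm_nonneg y)] at h1
  have h2 : HasFDerivAt (fun y : Euc d => ‖y‖ ^ 2) (2 • innerSL ℝ y) y := by
    have := (hasFDerivAt_id (𝕜 := ℝ) y).norm_sq
    simpa using! this
  have h3 := (h1.comp_hasFDerivAt y h2).const_mul (1 / 2)
  refine h3.congr_fderiv ?_
  ext v
  simp
  ring

lemma pot_cont (hφ : Continuous φ) : Continuous (pot φ : Euc d → ℝ) :=
  continuous_iff_continuousAt.2 fun y => (pot_hasFDeriv hφ y).continuousAt

lemma pot_nonneg (h0 : ∀ r, 0 ≤ φ r) (y : Euc d) : 0 ≤ pot φ y := by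
  unfold pot Phifun
  have : 0 ≤ ∫ s in (0:ℝ)..(‖y‖ ^ 2), φ (Real.sqrt s) :=
    intervalIntegral.integral_nonneg (by positivity) fun s _ => h0 _
  positivity

lemma HS.pot_le (H : HS lw lx lv φM φ ν) (y : Euc d) : pot φ y ≤ φM * ‖y‖ ^ 2 := by
  have := intervalIntegral.norm_integral_le_of_norm_le_const (a := 0) (b := ‖y‖ ^ 2) (f := fun s => φ (Real.sqrt s))
    (C := φM) (fun s _ => by rw [Real.norm_of_nonneg (H.φ0 _)]; exact H.φM _)
  rw [sub_zero, abs_of_nonneg (by positivity)] at this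
  have h2 := le_trans (le_abs_self _) this
  have h3 : 0 ≤ φM * ‖y‖ ^ 2 := mul_nonneg H.φM0 (by positivity)
  unfold pot Phifun
  linarith

def Psi (φ : ℝ → ℝ) (ρ : Measure (Phase d)) (z : Phase d) : ℝ := ∫ w, pot φ (z.1 - w.1) ∂ρ

def Lk (φ : ℝ → ℝ) (z w : Phase d) : Phase d →L[ℝ] ℝ :=
  (φ ‖z.1 - w.1‖ • innerSL ℝ (z.1 - w.1)).comp (ContinuousLinearMap.fst ℝ (Euc d) (Euc d))

lemma Lk_apply (z w y : Phase d) : Lk φ z w y = φ ‖z.1 - w.1‖ * ⟪z.1 - w.1, y.1⟫ := by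
  simp [Lk, inner_sub_left]

lemma Lk_deriv (hφ : Continuous φ) (w y : Phase d) :
    HasFDerivAt (fun y : Phase d => pot φ (y.1 - w.1)) (Lk φ y w) y := by
  have h1 : HasFDerivAt (fun y : Phase d => y.1 - w.1) (ContinuousLinearMap.fst ℝ (Euc d) (Euc d)) y :=
    hasFDerivAt_fst.sub_const _
  exact HasFDerivAt.comp (g := pot φ) (f := fun y : Phase d => y.1 - w.1) y (pot_hasFDeriv hφ (y.1 - w.1)) h1

lemma Lk_cont (hφ : Continuous φ) : Continuous (fun p : Phase d × Phase d => Lk φ p.1 p.2) := by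
  unfold Lk; fun_prop

lemma Lk_cont2 (hφ : Continuous φ) (z : Phase d) : Continuous (fun w : Phase d => Lk φ z w) := by
  unfold Lk; fun_prop

lemma HS.Lk_bound (H : HS lw lx lv φM φ ν) (z w : Phase d) : ‖Lk φ z w‖ ≤ φM * (‖z‖ + ‖w‖) := by
  have hM := H.φM0
  refine ContinuousLinearMap.opNorm_le_bound _ (by positivity) fun y => ?_
  have e : Lk φ z w y = φ ‖z.1 - w.1‖ * ⟪z.1 - w.1, y.1⟫ := Lk_apply z w y
  rw [e, norm_mul, Real.norm_of_nonneg (H.φ0 _), mul_assoc]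
  have h1 := norm_inner_le_norm (𝕜 := ℝ) (z.1 - w.1) y.1
  have h2 : ‖z.1 - w.1‖ ≤ ‖z‖ + ‖w‖ := (norm_sub_le _ _).trans (add_le_add (norm_fst_le z) (norm_fst_le w))
  have h3 := norm_fst_le y
  have h4 := H.φM ‖z.1 - w.1‖
  have h5 : ‖z.1 - w.1‖ * ‖y.1‖ ≤ (‖z‖ + ‖w‖) * ‖y‖ := by gcongr
  exact mul_le_mul h4 (h1.trans h5) (norm_nonneg _) hM

lemma HS.Psi_hasFDeriv (H : HS lw lx lv φM φ ν) (t : ℝ) (z : Phase d) :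
    HasFDerivAt (Psi φ (ν t)) (∫ w, Lk φ z w ∂(ν t)) z := by
  have hp := pot_cont (d := d) H.cφ
  have hL := Lk_cont (d := d) H.cφ
  have hM := H.φM0
  have a1 : ∀ y : Phase d, Integrable (fun w => pot φ (y.1 - w.1)) (ν t) := fun y => H.int t (by fun_prop)
  have a2 : Integrable (fun w => Lk φ z w) (ν t) := by
    have := Lk_cont2 H.cφ z
    exact H.int t this
  have a3 : Integrable (fun w : Phase d => φM * ((‖z‖ + 1) + ‖w‖)) (ν t) := H.int t (by fun_prop)
  have a4 : ∀ᵐ w ∂(ν t), ∀ y ∈ Metric.ball z 1, ‖Lk φ y w‖ ≤ φM * ((‖z‖ + 1) + ‖w‖) := by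
    refine ae_of_all _ fun w y hy => (H.Lk_bound y w).trans ?_
    rw [mem_ball_iff_norm] at hy
    have : ‖y‖ ≤ ‖z‖ + 1 := by
      have := norm_le_norm_add_norm_sub' y z
      linarith
    gcongr
  have a5 : ∀ᵐ w ∂(ν t), ∀ y ∈ Metric.ball z 1, HasFDerivAt (fun y : Phase d => pot φ (y.1 - w.1)) (Lk φ y w) y :=
    ae_of_all _ fun w y _ => Lk_deriv H.cφ w y
  exact hasFDerivAt_integral_of_dominated_of_fderiv_le (μ := ν t)
    (F := fun (z : Phase d) (w : Phase d) => pot φ (z.1 - w.1))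
    (F' := fun z w => Lk φ z w) (bound := fun w => φM * ((‖z‖ + 1) + ‖w‖)) (s := Metric.ball z 1)
    (Metric.ball_mem_nhds z one_pos) (Eventually.of_forall fun y => (a1 y).aestronglyMeasurable)
    (a1 z) a2.aestronglyMeasurable a4 a3 a5

lemma HS.Psi_contDiff (H : HS lw lx lv φM φ ν) (t : ℝ) : ContDiff ℝ 1 (Psi φ (ν t)) := by
  rw [contDiff_one_iff_fderiv]
  refine ⟨fun z => (H.Psi_hasFDeriv t z).differentiableAt, ?_⟩
  have e : fderiv ℝ (Psi φ (ν t)) = fun z => ∫ w, Lk φ z w ∂(ν t) := funext fun z => (H.Psi_hasFDeriv t z).fderiv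
  rw [e]
  obtain ⟨K, hK, h0⟩ := H.cpt t
  have hp := H.prob t
  have h1 : (ν t).restrict K = ν t := Measure.restrict_eq_self_of_ae_mem (by rw [ae_iff]; exact h0)
  have := continuous_parametric_integral_of_continuous (μ := ν t) (f := fun z w => Lk φ z w) (Lk_cont (d := d) H.cφ) hK
  rwa [h1] at this

lemma HS.Psi_bounds (H : HS lw lx lv φM φ ν) (t : ℝ) : ∃ A, 0 ≤ A ∧ (∀ z, |Psi φ (ν t) z| ≤ A * (1 + ‖z‖) ^ 2) ∧
    ∀ z, ‖fderiv ℝ (Psi φ (ν t)) z‖ ≤ A * (1 + ‖z‖) := by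
  have hM := H.φM0
  have hp := pot_cont (d := d) H.cφ
  have i0 : 0 ≤ ∫ w, (1 + ‖w‖) ^ 2 ∂(ν t) := integral_nonneg fun w => by positivity
  refine ⟨φM * ∫ w, (1 + ‖w‖) ^ 2 ∂(ν t), by positivity, fun z => ?_, fun z => ?_⟩
  · have : |Psi φ (ν t) z| ≤ ∫ w, φM * (1 + ‖z‖) ^ 2 * (1 + ‖w‖) ^ 2 ∂(ν t) := by
      have hi : Integrable (fun w : Phase d => φM * (1 + ‖z‖) ^ 2 * (1 + ‖w‖) ^ 2) (ν t) := H.int t (by fun_prop)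
      rw [← Real.norm_eq_abs]
      refine norm_integral_le_of_norm_le (f := fun w : Phase d => pot φ (z.1 - w.1)) hi (ae_of_all _ fun w => ?_)
      rw [Real.norm_of_nonneg (pot_nonneg H.φ0 _), mul_assoc]
      refine (H.pot_le _).trans ?_
      refine mul_le_mul_of_nonneg_left ?_ hM
      rw [← mul_pow]
      have h2 : ‖z.1 - w.1‖ ≤ ‖z‖ + ‖w‖ := (norm_sub_le _ _).trans (add_le_add (norm_fst_le z) (norm_fst_le w))
      gcongr
      nlinarith [norm_nonneg z, norm_nonneg w, mul_nonneg (norm_nonneg z) (norm_nonneg w)]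
    refine this.trans (le_of_eq ?_)
    rw [integral_const_mul]; ring
  · rw [(H.Psi_hasFDeriv t z).fderiv]
    have : ‖∫ w, Lk φ z w ∂(ν t)‖ ≤ ∫ w, φM * (1 + ‖z‖) * (1 + ‖w‖) ^ 2 ∂(ν t) := by
      have hi : Integrable (fun w : Phase d => φM * (1 + ‖z‖) * (1 + ‖w‖) ^ 2) (ν t) := H.int t (by fun_prop)
      refine norm_integral_le_of_norm_le hi (ae_of_all _ fun w => ?_)
      rw [mul_assoc]
      refine (H.Lk_bound z w).trans ?_
      refine mul_le_mul_of_nonneg_left ?_ hM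
      have a := norm_nonneg z
      have b := norm_nonneg w
      nlinarith [mul_nonneg a b, mul_nonneg a (mul_nonneg b b), mul_nonneg b b]
    refine this.trans (le_of_eq ?_)
    rw [integral_const_mul]; ring

def kap (φ : ℝ → ℝ) (p : Phase d × Phase d) : ℝ := φ ‖p.1.1 - p.2.1‖ * ⟪p.1.1 - p.2.1, p.1.2⟫

lemma kap_cont (hφ : Continuous φ) : Continuous (kap φ : Phase d × Phase d → ℝ) := by
  unfold kap; fun_prop

def Jf (φ : ℝ → ℝ) (ν : ℝ → Measure (Phase d)) (p : ℝ × ℝ) : ℝ := ∫ q, kap φ q ∂((ν p.1).prod (ν p.2))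

lemma HS.Jf_cont (H : HS lw lx lv φM φ ν) : Continuous (Jf φ ν) := by
  have hM := H.φM0
  refine H.cont_quad2 H.m2_cont (kap_cont H.cφ) (2 * φM) fun p => ?_
  unfold kap
  rw [abs_mul, abs_of_nonneg (H.φ0 _), mul_comm 2 φM, mul_assoc]
  refine mul_le_mul (H.φM _) ?_ (abs_nonneg _) hM
  refine (abs_real_inner_le_norm _ _).trans ?_
  have h1 := norm_sub_le p.1.1 p.2.1
  have := norm_nonneg p.1.1
  have := norm_nonneg p.2.1
  have h3 := norm_nonneg p.1.2
  have h2 : ‖p.1.1 - p.2.1‖ * ‖p.1.2‖ ≤ (‖p.1.1‖ + ‖p.2.1‖) * ‖p.1.2‖ := by gcongr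
  unfold Nn
  nlinarith [sq_nonneg (‖p.1.1‖ - ‖p.1.2‖), sq_nonneg (‖p.2.1‖ - ‖p.1.2‖), sq_nonneg (‖p.2.2‖)]

lemma HS.Fop_Psi (H : HS lw lx lv φM φ ν) (s t : ℝ) : Fop lw lx lv φ ν (Psi φ (ν t)) s = Jf φ ν (s, t) := by
  have := H.prob s
  have := H.prob t
  have hφ := H.cφ
  unfold Jf
  rw [integral_prod _ (H.int2 s t (kap_cont H.cφ))]
  unfold Fop
  congr 1
  funext z
  have hc : Continuous (fun w => Lk φ z w) := by unfold Lk; fun_prop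
  have e : ∀ y, fderiv ℝ (Psi φ (ν t)) z y = ∫ w, Lk φ z w y ∂(ν t) := by
    intro y
    rw [(H.Psi_hasFDeriv t z).fderiv, ContinuousLinearMap.integral_apply (H.int t hc)]
  simp_rw [e]
  simp only [Lk_apply, kap, integral_const, probReal_univ, one_smul]

def Mf (φ : ℝ → ℝ) (ν : ℝ → Measure (Phase d)) (t : ℝ) : ℝ := ∫ z, Psi φ (ν t) z ∂(ν t)

lemma HS.Psi_symm (H : HS lw lx lv φM φ ν) (a b : ℝ) : ∫ z, Psi φ (ν a) z ∂(ν b) = ∫ z, Psi φ (ν b) z ∂(ν a) := by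
  have := H.prob a
  have := H.prob b
  have hp := pot_cont (d := d) H.cφ
  unfold Psi
  rw [integral_integral_swap (H.int2 b a (f := fun p => pot φ (p.1.1 - p.2.1)) (by fun_prop))]
  congr 1; funext z; congr 1; funext w
  unfold pot
  rw [norm_sub_rev]

lemma HS.Mf_diff (H : HS lw lx lv φM φ ν) {a b : ℝ} (ha : 0 ≤ a) (hb : 0 ≤ b) :
    Mf φ ν b - Mf φ ν a = ∫ s in a..b, (Jf φ ν (s, b) + Jf φ ν (s, a)) := by
  have hJ := H.Jf_cont
  have main : ∀ a b : ℝ, 0 ≤ a → a ≤ b → Mf φ ν b - Mf φ ν a = ∫ s in a..b, (Jf φ ν (s, b) + Jf φ ν (s, a)) := by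
    intro a b ha hab
    have e : ∀ t, ∫ z, Psi φ (ν t) z ∂(ν b) - ∫ z, Psi φ (ν t) z ∂(ν a) = ∫ s in a..b, Jf φ ν (s, t) := by
      intro t
      obtain ⟨A, hA, h1, h2⟩ := H.Psi_bounds t
      rw [H.ewf' (H.Psi_contDiff t) hA h1 h2 ha hab]
      simp_rw [H.Fop_Psi]
    rw [intervalIntegral.integral_add (Continuous.intervalIntegrable (by fun_prop) _ _) (Continuous.intervalIntegrable (by fun_prop) _ _), ← e, ← e,
      H.Psi_symm b a]
    unfold Mf
    ring
  rcases le_total a b with h | h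
  · exact main a b ha h
  · have := main b a hb h
    rw [intervalIntegral.integral_symm]
    simp_rw [add_comm (Jf φ ν (_, b))]
    linarith

lemma HS.Mf_deriv (H : HS lw lx lv φM φ ν) {t : ℝ} (ht : 0 < t) : HasDerivAt (Mf φ ν) (2 * Jf φ ν (t, t)) t := by
  rw [hasDerivAt_iff_isLittleO, Asymptotics.isLittleO_iff]
  intro c hc
  have hJ := H.Jf_cont.tendsto (t, t)
  rw [Metric.tendsto_nhds_nhds] at hJ
  obtain ⟨δ, hδ, h⟩ := hJ (c / 2) (by positivity)
  filter_upwards [Metric.ball_mem_nhds t hδ, lt_mem_nhds ht] with u hu hu0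
  rw [H.Mf_diff ht.le hu0.le]
  have hJc := H.Jf_cont
  have e : (u - t) • (2 * Jf φ ν (t, t)) = ∫ s in t..u, (2 * Jf φ ν (t, t)) := by simp; ring
  rw [e, ← intervalIntegral.integral_sub (Continuous.intervalIntegrable (by fun_prop) _ _) (by simp)]
  refine intervalIntegral.norm_integral_le_of_norm_le_const fun s hs => ?_
  have hst : dist s t < δ := by
    rw [Metric.mem_ball, Real.dist_eq] at hu
    rw [Real.dist_eq]
    exact (abs_sub_left_of_mem_uIcc (uIoc_subset_uIcc hs)).trans_lt hu
  have h1 := h (x := (s, u)) (by rw [Prod.dist_eq]; exact max_lt hst hu)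
  have h2 := h (x := (s, t)) (by rw [Prod.dist_eq]; exact max_lt hst (by simpa using hδ))
  rw [Real.dist_eq] at h1 h2
  rw [Real.norm_eq_abs]
  have := abs_add_le (Jf φ ν (s, u) - Jf φ ν (t, t)) (Jf φ ν (s, t) - Jf φ ν (t, t))
  rw [show Jf φ ν (s, u) + Jf φ ν (s, t) - 2 * Jf φ ν (t, t) = (Jf φ ν (s, u) - Jf φ ν (t, t)) + (Jf φ ν (s, t) - Jf φ ν (t, t)) by ring]
  linarith
end


section
variable {d : ℕ} {lw lx lv φM : ℝ} {φ : ℝ → ℝ} {ν : ℝ → Measure (Phase d)}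

lemma barbalat (V : ℝ → ℝ) (hc : Continuous V) (h0 : ∀ t, 0 ≤ V t) (L B : ℝ)
    (hL : ∀ a b, 1 ≤ a → a ≤ b → |V b - V a| ≤ L * (b - a))
    (hB : ∀ t, 1 ≤ t → ∫ s in (1:ℝ)..t, V s ≤ B) : Tendsto V atTop (𝓝 0) := by
  have hi : ∀ a b, IntervalIntegrable V volume a b := fun a b => hc.intervalIntegrable a b
  have hL0 : 0 ≤ L := by
    have := (abs_nonneg _).trans (hL 1 2 le_rfl (by norm_num))
    linarith
  -- the primitive, frozen before time 1
  have hmono : Monotone (fun t => ∫ s in (1:ℝ)..(max t 1), V s) := by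
    intro a b hab
    have : (∫ s in (1:ℝ)..(max b 1), V s) - ∫ s in (1:ℝ)..(max a 1), V s = ∫ s in (max a 1)..(max b 1), V s :=
      intervalIntegral.integral_interval_sub_left (hi _ _) (hi _ _)
    have h2 : 0 ≤ ∫ s in (max a 1)..(max b 1), V s :=
      intervalIntegral.integral_nonneg (max_le_max hab le_rfl) fun s _ => h0 s
    simp only
    linarith
  have hlim := tendsto_atTop_ciSup hmono ⟨B, by rintro _ ⟨t, rfl⟩; exact hB _ (le_max_right _ _)⟩
  rw [Metric.tendsto_atTop]
  intro ε hε
  obtain ⟨δ, hδ, hδ2⟩ : ∃ δ : ℝ, 0 < δ ∧ L * δ ≤ ε / 2 := by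
    refine ⟨ε / (2 * (L + 1)), by positivity, ?_⟩
    rw [mul_div_assoc', div_le_div_iff₀ (by positivity) (by positivity)]
    nlinarith
  obtain ⟨N, hN⟩ := Metric.tendsto_atTop.1 hlim (δ * ε / 4) (by positivity)
  refine ⟨max N 1, fun t ht => ?_⟩
  have ht1 : 1 ≤ t := (le_max_right _ _).trans ht
  have htN : N ≤ t := (le_max_left _ _).trans ht
  have e1 := hN t htN
  have e2 := hN (t + δ) (by linarith)
  rw [Real.dist_eq, abs_lt] at e1 e2
  rw [max_eq_left ht1] at e1
  rw [max_eq_left (by linarith : (1:ℝ) ≤ t + δ)] at e2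
  have : (∫ s in (1:ℝ)..(t + δ), V s) - ∫ s in (1:ℝ)..t, V s = ∫ s in t..(t + δ), V s :=
    intervalIntegral.integral_interval_sub_left (hi _ _) (hi _ _)
  have h3 : ∫ s in t..(t + δ), (V t - L * δ) ≤ ∫ s in t..(t + δ), V s := by
    refine intervalIntegral.integral_mono_on (by linarith) (by simp) (hi _ _) fun s hs => ?_
    have := (abs_le.1 (hL t s ht1 hs.1)).1
    have h4 : L * (s - t) ≤ L * δ := mul_le_mul_of_nonneg_left (by linarith [hs.2]) hL0
    linarith
  simp only [intervalIntegral.integral_const, add_sub_cancel_left, smul_eq_mul] at h3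
  rw [Real.dist_eq, sub_zero, abs_of_nonneg (h0 t)]
  have h5 : δ * (V t - L * δ) < δ * (ε / 2) := by linarith [e1.1, e1.2, e2.1, e2.2]
  have := lt_of_mul_lt_mul_left h5 hδ.le
  linarith

/-- dissipation -/
lemma HS.diss (H : HS lw lx lv φM φ ν) {φm : ℝ} (hm : ∀ r, φm ≤ φ r) (t : ℝ) :
    lw * Fop lw lx lv φ ν (fun z => ‖z.1‖ ^ 2) t + Fop lw lx lv φ ν (fun z => ‖z.2‖ ^ 2) t
      + lx * (2 * Jf φ ν (t, t)) ≤ - (2 * lv * φm) * ∫ z, ‖z.2‖ ^ 2 ∂(ν t) := by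
  have := H.prob t
  have hφ := H.cφ
  have hlv := H.lv0
  set P := (ν t).prod (ν t) with hP
  have hi : ∀ {f : Phase d × Phase d → ℝ}, Continuous f → Integrable f P := fun hf => H.int2 t t hf
  have hG1 := Gk_cont (lw := lw) (lx := lx) (lv := lv) (d := d) H.cφ nsq1_contDiff
  have hG2 := Gk_cont (lw := lw) (lx := lx) (lv := lv) (d := d) H.cφ nsq2_contDiff
  have hk := kap_cont (d := d) H.cφ
  -- cross terms
  have z1 : ∫ p, ⟪p.1.2, p.2.1⟫ ∂P = 0 := by
    rw [hP, integral_prod _ (H.int2 t t (by fun_prop))]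
    have : ∀ z : Phase d, ∫ w : Phase d, ⟪z.2, w.1⟫ ∂(ν t) = 0 := fun z => by
      rw [integral_inner (H.int t (by fun_prop)), H.c1, inner_zero_right]
    simp [this]
  have z2 : ∫ p, ⟪p.1.2, p.2.2⟫ ∂P = 0 := by
    rw [hP, integral_prod _ (H.int2 t t (by fun_prop))]
    have : ∀ z : Phase d, ∫ w : Phase d, ⟪z.2, w.2⟫ ∂(ν t) = 0 := fun z => by
      rw [integral_inner (H.int t (by fun_prop)), H.c2, inner_zero_right]
    simp [this]
  have s1 : ∫ p, ‖p.1.2‖ ^ 2 ∂P = ∫ z, ‖z.2‖ ^ 2 ∂(ν t) := by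
    rw [hP, integral_prod _ (H.int2 t t (by fun_prop))]
    simp
  have s2 : ∫ p, ‖p.2.2‖ ^ 2 ∂P = ∫ z, ‖z.2‖ ^ 2 ∂(ν t) := by
    rw [hP, integral_prod _ (H.int2 t t (by fun_prop))]
    simp
  let f : Phase d × Phase d → ℝ := fun p => φ ‖p.1.1 - p.2.1‖ * ⟪p.1.2, p.2.2 - p.1.2⟫
  have hf : Continuous f := by unfold f; fun_prop
  have e : lw * Fop lw lx lv φ ν (fun z => ‖z.1‖ ^ 2) t + Fop lw lx lv φ ν (fun z => ‖z.2‖ ^ 2) t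
      + lx * (2 * Jf φ ν (t, t)) = 2 * lv * ∫ p, f p ∂P := by
    have : ∫ p, (2 * lw * ⟪p.1.2, p.2.1⟫ + 2 * lv * f p) ∂P = 2 * lv * ∫ p, f p ∂P := by
      rw [integral_add (hi (by fun_prop)) (hi (by fun_prop)), integral_const_mul, integral_const_mul, z1]
      ring
    rw [← this, H.Fop_eq nsq1_contDiff, H.Fop_eq nsq2_contDiff, Jf, ← hP, ← integral_const_mul, ← integral_const_mul,
      ← integral_const_mul, ← integral_add (hi (by fun_prop)) (hi (by fun_prop)),
      ← integral_add (hi (by fun_prop)) (hi (by fun_prop))]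
    congr 1
    funext p
    simp only [Gk, fderiv_nsq1, fderiv_nsq2, kap, qk, f, inner_add_right, inner_smul_right, inner_sub_right,
      inner_sub_left, real_inner_comm p.1.2 p.1.1, real_inner_comm p.1.2 p.2.1]
    ring
  have hsw : ∫ p, f p.swap ∂P = ∫ p, f p ∂P := integral_prod_swap f
  have hle : ∫ p, (f p + f p.swap) ∂P ≤ ∫ p, (2 * φm * ⟪p.1.2, p.2.2⟫ - φm * ‖p.1.2‖ ^ 2 - φm * ‖p.2.2‖ ^ 2) ∂P := by
    refine integral_mono (hi (by fun_prop)) (hi (by fun_prop)) fun p => ?_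
    have h1 : f p + f p.swap = - (φ ‖p.1.1 - p.2.1‖ * ‖p.1.2 - p.2.2‖ ^ 2) := by
      simp only [f, Prod.fst_swap, Prod.snd_swap]
      rw [norm_sub_rev p.2.1 p.1.1, norm_sub_sq_real, inner_sub_right, inner_sub_right, real_inner_self_eq_norm_sq,
        real_inner_self_eq_norm_sq, real_inner_comm p.1.2 p.2.2]
      ring
    have h2 : φm * ‖p.1.2 - p.2.2‖ ^ 2 ≤ φ ‖p.1.1 - p.2.1‖ * ‖p.1.2 - p.2.2‖ ^ 2 := by
      gcongr
      exact hm _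
    simp only [h1]
    have h3 := norm_sub_sq_real p.1.2 p.2.2
    rw [h3] at h2 ⊢
    linarith
  rw [integral_add (hi hf) (hi (by fun_prop)), hsw, integral_sub (hi (by fun_prop)) (hi (by fun_prop)),
    integral_sub (hi (by fun_prop)) (hi (by fun_prop)), integral_const_mul, integral_const_mul, integral_const_mul,
    z2, s1, s2] at hle
  rw [e]
  nlinarith

lemma HS.final (H : HS lw lx lv φM φ ν) {φm : ℝ} (hm0 : 0 < φm) (hm : ∀ r, φm ≤ φ r) :
    Tendsto (Vfun ν) atTop (𝓝 0) := by
  have hlw := H.lw0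
  have hlx := H.lx0
  have hlv := H.lv0
  have b1 : ∀ z : Phase d, ‖fderiv ℝ (fun z : Phase d => ‖z.1‖ ^ 2) z‖ ≤ 4 * (1 + ‖z‖) := fun z =>
    (nsq1_b2 z).trans (by linarith [norm_nonneg z])
  have b2 : ∀ z : Phase d, ‖fderiv ℝ (fun z : Phase d => ‖z.2‖ ^ 2) z‖ ≤ 4 * (1 + ‖z‖) := fun z =>
    (nsq2_b2 z).trans (by linarith [norm_nonneg z])
  have dX : ∀ t, 0 < t → HasDerivAt (Xfun ν) (Fop lw lx lv φ ν (fun z => ‖z.1‖ ^ 2) t) t := fun t ht =>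
    H.hasDeriv nsq1_contDiff (by norm_num) nsq1_b1 b1 ht
  have dV : ∀ t, 0 < t → HasDerivAt (Vfun ν) (Fop lw lx lv φ ν (fun z => ‖z.2‖ ^ 2) t) t := fun t ht =>
    H.hasDeriv nsq2_contDiff (by norm_num) nsq2_b1 b2 ht
  have V0 : ∀ t, 0 ≤ Vfun ν t := fun t => integral_nonneg fun z => by positivity
  have X0 : ∀ t, 0 ≤ Xfun ν t := fun t => integral_nonneg fun z => by positivity
  have M0 : ∀ t, 0 ≤ Mf φ ν t := fun t => integral_nonneg fun z => integral_nonneg fun w => pot_nonneg H.φ0 _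
  have hm2 : ∀ t, ∫ z, Nn z ∂(ν t) = Xfun ν t + Vfun ν t := fun t =>
    integral_add (H.int t (by fun_prop)) (H.int t (by fun_prop))
  have Vc : Continuous (Vfun ν) := by
    have h1 := H.cont_quad2 H.m2_cont (f := fun p => ‖p.1.2‖ ^ 2) (by fun_prop) 1 (fun p => by
      rw [abs_of_nonneg (by positivity)]
      have := Nn_nonneg p.2
      have := sq_nonneg ‖p.1.1‖
      unfold Nn at *
      linarith)
    have h2 : Continuous (fun s => ∫ p, ‖p.1.2‖ ^ 2 ∂((ν s).prod (ν s))) :=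
      h1.comp (f := fun s : ℝ => (s, s)) (by fun_prop)
    refine h2.congr fun s => ?_
    have := H.prob s
    rw [integral_prod _ (H.int2 s s (by fun_prop))]
    simp [Vfun]
  set c := 2 * lv * φm with hc
  have hc0 : 0 < c := by positivity
  let E : ℝ → ℝ := fun t => lw * Xfun ν t + Vfun ν t + lx * Mf φ ν t
  have E0 : ∀ t, 0 ≤ E t := fun t => by
    have := X0 t; have := V0 t; have := M0 t
    simp only [E]; positivity
  let W : ℝ → ℝ := fun t => E t + c * ∫ s in (1:ℝ)..t, Vfun ν s
  have dW : ∀ t, 0 < t → HasDerivAt W (lw * Fop lw lx lv φ ν (fun z => ‖z.1‖ ^ 2) t + Fop lw lx lv φ ν (fun z => ‖z.2‖ ^ 2) t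
      + lx * (2 * Jf φ ν (t, t)) + c * Vfun ν t) t := fun t ht =>
    ((((dX t ht).const_mul lw).add (dV t ht)).add ((H.Mf_deriv ht).const_mul lx)).add
      ((Vc.integral_hasStrictDerivAt 1 t).hasDerivAt.const_mul c)
  have Wanti : AntitoneOn W (Ici 1) := by
    refine antitoneOn_of_deriv_nonpos (convex_Ici 1) (fun t ht => ?_) (fun t ht => ?_) fun t ht => ?_
    · exact (dW t (lt_of_lt_of_le one_pos ht)).continuousAt.continuousWithinAt
    · rw [interior_Ici] at ht
      exact (dW t (one_pos.trans ht)).differentiableAt.differentiableWithinAt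
    · rw [interior_Ici] at ht
      rw [(dW t (one_pos.trans ht)).deriv]
      have := H.diss hm t
      unfold Vfun
      linarith
  have W1 : W 1 = E 1 := by simp [W]
  have key : ∀ t, 1 ≤ t → E t + c * ∫ s in (1:ℝ)..t, Vfun ν s ≤ E 1 := fun t ht => by
    have := Wanti (mem_Ici.2 le_rfl) (mem_Ici.2 ht) ht
    rwa [W1] at this
  have I0 : ∀ t, 1 ≤ t → 0 ≤ ∫ s in (1:ℝ)..t, Vfun ν s := fun t ht =>
    intervalIntegral.integral_nonneg ht fun s _ => V0 s
  have Eb : ∀ t, 1 ≤ t → E t ≤ E 1 := fun t ht => by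
    have := key t ht
    have := mul_nonneg hc0.le (I0 t ht)
    linarith
  have hS : ∀ t, 1 ≤ t → ∫ z, Nn z ∂(ν t) ≤ E 1 / lw + E 1 := fun t ht => by
    rw [hm2]
    have h1 := Eb t ht
    have h2 := mul_nonneg hlx.le (M0 t)
    have h3 := mul_nonneg hlw.le (X0 t)
    have h4 := V0 t
    simp only [E] at h1
    refine add_le_add ?_ ?_
    · rw [le_div_iff₀ hlw]; simp only [E]; linarith
    · simp only [E]; linarith
  have hCq := H.Cq0
  refine barbalat _ Vc V0 ((2 * 4 * Cq lw lx lv φM) * (1 + 2 * (E 1 / lw + E 1))) (E 1 / c) ?_ ?_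
  · intro a b ha hab
    have h1 := H.ewf' nsq2_contDiff (by norm_num) nsq2_b1 b2 (zero_le_one.trans ha) hab
    have h2 : Vfun ν b - Vfun ν a = ∫ s in a..b, Fop lw lx lv φ ν (fun z => ‖z.2‖ ^ 2) s := h1
    rw [h2]
    have h3 := intervalIntegral.norm_integral_le_of_norm_le_const (a := a) (b := b)
      (f := Fop lw lx lv φ ν (fun z => ‖z.2‖ ^ 2)) (C := (2 * 4 * Cq lw lx lv φM) * (1 + 2 * (E 1 / lw + E 1))) (by
        intro s hs
        rw [uIoc_of_le hab] at hs
        refine (H.Fop_bound nsq2_contDiff (by norm_num) b2 s).trans ?_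
        have := hS s (ha.trans hs.1.le)
        gcongr)
    rwa [abs_of_nonneg (sub_nonneg.2 hab)] at h3
  · intro t ht
    rw [le_div_iff₀ hc0]
    have := key t ht
    have := E0 t
    linarith
end

/-- asymptotic vanishing of the velocity variance, `lim_{t→∞} V(t) = 0`,
for centered compactly supported measure-valued probability solutions with
`0 < φ_m ≤ φ ≤ φ_M`. -/
theorem kinetic_herding_velocity_variance_vanishes
    {d : ℕ} (hd : 1 ≤ d) (lw lx lv : ℝ) (hlw : 0 < lw) (hlx : 0 < lx) (hlv : 0 < lv)
    (φ : ℝ → ℝ) (Kφ : NNReal) (hLip : LipschitzWith Kφ φ)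
    (φm φM : ℝ) (hφm : 0 < φm) (hφ : ∀ r, φm ≤ φ r ∧ φ r ≤ φM)
    (μ : ℝ → Measure (Phase d))
    (hsol : IsMVSol lw lx lv φ (Set.Ici 0) μ)
    (hprob : ∀ t ∈ Set.Ici (0:ℝ), IsProbabilityMeasure (μ t))
    (hcpt : ∀ t ∈ Set.Ici (0:ℝ), MeasureCompactSupport (μ t))
    (hcent : ∀ t ∈ Set.Ici (0:ℝ), (∫ z, z.1 ∂(μ t)) = 0 ∧ (∫ z, z.2 ∂(μ t)) = 0) :
    Tendsto (Vfun μ) atTop (nhds 0) := by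
  have H := mkHS hlw hlx hlv hLip.continuous hφm hφ hsol hprob hcpt hcent
  refine (H.final hφm fun r => (hφ r).1).congr' ?_
  filter_upwards [eventually_ge_atTop (0 : ℝ)] with t ht
  simp only [Vfun, max_eq_left ht]
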